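/- Let (G_i)_{i∈ℕ} be a recursively enumerated family of finitely generated groups with decidable word problem: there are a computable function n : ℕ → ℕ, surjective homomorphisms π_i from the free group on n(i) generators onto G_i, and a computable two-variable predicate deciding for each pair (i, w), where w is a word over the n(i) generators and their inverses, whether π_i(w) = 1 in G_i. Then there exists a finitely generated simple group H with decidable word problem such that every G_i admits an embedding into H that is simultaneously quasi-isometric and Frattini. -/

import Mathlib

-- The sign (−1, 0, or 1) of a group element relative to the identity,
-- with respect to a linear order `l`.
open Classical in
noncomputable def orderSign {H : Type*} [Group H] (l : LinearOrder H) (h : H) : ℤ :=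
  if l.lt h 1 then -1 else if h = 1 then 0 else 1

/-- A group is left-orderable if it carries a left-invariant linear order. -/
def IsLeftOrderable (G : Type*) [Group G] : Prop :=
  ∃ l : LinearOrder G, ∀ a b c : G, l.le b c → l.le (a * b) (a * c)

/-- A Frattini embedding: an injective homomorphism preserving and reflecting conjugacy. -/
def IsFrattini {G H : Type*} [Group G] [Group H] (φ : G →* H) : Prop :=
  Function.Injective φ ∧ ∀ a b : G, IsConj a b ↔ IsConj (φ a) (φ b)

/-- `X` is a (finite) generating set of the group. -/
def Generates {G : Type*} [Group G] (X : Finset G) : Prop :=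
  Subgroup.closure (X : Set G) = ⊤

/-- Word length of `g` with respect to the finite set `X`: the least length of a word
over `X ∪ X⁻¹` representing `g`. -/
noncomputable def wordLength {G : Type*} [Group G] (X : Finset G) (g : G) : ℕ :=
  sInf {n | ∃ w : List G, w.length = n ∧ (∀ a ∈ w, a ∈ X ∨ a⁻¹ ∈ X) ∧ w.prod = g}

/-- Quasi-isometric embedding with respect to finite generating sets `X` and `Y`. -/
noncomputable def IsQIEmbedding {G H : Type*} [Group G] [Group H]
    (X : Finset G) (Y : Finset H) (φ : G →* H) : Prop :=
  Function.Injective φ ∧ ∃ C k : ℝ, 0 < C ∧ 0 < k ∧ ∀ g : G,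
    (1 / C) * (wordLength X g : ℝ) - k ≤ (wordLength Y (φ g) : ℝ) ∧
    (wordLength Y (φ g) : ℝ) ≤ C * (wordLength X g : ℝ) + k

/-- Evaluation of a formal word (list of pairs (index, sign)) over the
enumerated sequence `x : ℕ → G`. -/
def evalWord {G : Type*} [Group G] (x : ℕ → G) (w : List (ℕ × Bool)) : G :=
  (w.map (fun p => if p.2 then x p.1 else (x p.1)⁻¹)).prod

/-- A computable left order on a countable group with respect to an enumerated
generating sequence `x : ℕ → G`. -/
def ComputableLeftOrderWrt {G : Type*} [Group G] (x : ℕ → G) : Prop :=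
  ∃ l : LinearOrder G, (∀ a b c : G, l.le b c → l.le (a * b) (a * c)) ∧
    Computable (fun w : List (ℕ × Bool) => orderSign l (evalWord x w))

/-- A computable left order on a finitely generated group, presented by
a surjection `π` from a free group of finite rank. -/
def ComputableLeftOrderVia {H : Type*} [Group H] {m : ℕ}
    (π : FreeGroup (Fin m) →* H) : Prop :=
  ∃ l : LinearOrder H, (∀ a b c : H, l.le b c → l.le (a * b) (a * c)) ∧
    Computable (fun w : List (Fin m × Bool) => orderSign l (π (FreeGroup.mk w)))

/-- The embedding `φ` is computable: one can compute, for each `i`, a word over the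
generators of `H` representing `φ (x i)`. -/
def ComputableEmbedding {G H : Type*} [Group G] [Group H] (x : ℕ → G) {m : ℕ}
    (π : FreeGroup (Fin m) →* H) (φ : G →* H) : Prop :=
  ∃ f : ℕ → List (Fin m × Bool), Computable f ∧ ∀ i, π (FreeGroup.mk (f i)) = φ (x i)

/-- Decidable membership problem for the image of `φ` in `H`, presented via `π`. -/
def DecidableMembership {G H : Type*} [Group G] [Group H] {m : ℕ}
    (π : FreeGroup (Fin m) →* H) (φ : G →* H) : Prop :=
  ComputablePred (fun w : List (Fin m × Bool) => π (FreeGroup.mk w) ∈ φ.range)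

/-- Decidable word problem for `H`, presented via `π`. -/
def DecidableWordProblemVia {H : Type*} [Group H] {m : ℕ}
    (π : FreeGroup (Fin m) →* H) : Prop :=
  ComputablePred (fun w : List (Fin m × Bool) => π (FreeGroup.mk w) = 1)

/-- A group is finitely presented: quotient of a finite-rank free group by the
normal closure of finitely many relators. -/
def IsFinitelyPresented (K : Type*) [Group K] : Prop :=
  ∃ (m : ℕ) (π : FreeGroup (Fin m) →* K) (R : Finset (FreeGroup (Fin m))),
    Function.Surjective π ∧ π.ker = Subgroup.normalClosure (R : Set (FreeGroup (Fin m)))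


section QIpart

theorem wordLength_le_of {G : Type*} [Group G] (X : Finset G) (w : List G)
    (hw : ∀ a ∈ w, a ∈ X ∨ a⁻¹ ∈ X) : wordLength X w.prod ≤ w.length :=
  Nat.sInf_le ⟨w, rfl, hw, rfl⟩

theorem exists_word_of_generates {G : Type*} [Group G] {X : Finset G} (hX : Generates X) (g : G) :
    ∃ w : List G, (∀ a ∈ w, a ∈ X ∨ a⁻¹ ∈ X) ∧ w.prod = g := by
  have hg : g ∈ Subgroup.closure (X : Set G) := by
    rw [show Subgroup.closure (X : Set G) = ⊤ from hX]; trivial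
  rw [← Subgroup.mem_toSubmonoid, Subgroup.closure_toSubmonoid] at hg
  obtain ⟨l, hl, rfl⟩ := Submonoid.exists_list_of_mem_closure hg
  exact ⟨l, fun a ha => by simpa using hl a ha, rfl⟩

theorem exists_word_length {G : Type*} [Group G] {X : Finset G} (hX : Generates X) (g : G) :
    ∃ w : List G, w.length = wordLength X g ∧ (∀ a ∈ w, a ∈ X ∨ a⁻¹ ∈ X) ∧ w.prod = g := by
  obtain ⟨w, hw, hg⟩ := exists_word_of_generates hX g
  have hne : {n | ∃ w : List G, w.length = n ∧ (∀ a ∈ w, a ∈ X ∨ a⁻¹ ∈ X) ∧ w.prod = g}.Nonempty :=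
    ⟨_, w, rfl, hw, hg⟩
  exact Nat.sInf_mem hne

theorem wordLength_one {G : Type*} [Group G] (X : Finset G) : wordLength X (1 : G) = 0 := by
  have := wordLength_le_of X [] (by simp)
  simpa using this

theorem wordLength_mul_le {G : Type*} [Group G] {X : Finset G} (hX : Generates X) (g h : G) :
    wordLength X (g * h) ≤ wordLength X g + wordLength X h := by
  obtain ⟨w, hl, hw, hg⟩ := exists_word_length hX g
  obtain ⟨w', hl', hw', hg'⟩ := exists_word_length hX h
  have := wordLength_le_of X (w ++ w') (by
    intro a ha
    rcases List.mem_append.1 ha with h | h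
    · exact hw a h
    · exact hw' a h)
  simpa [hg, hg', hl, hl'] using this

theorem wordLength_inv_le {G : Type*} [Group G] {X : Finset G} (hX : Generates X) (g : G) :
    wordLength X g⁻¹ ≤ wordLength X g := by
  obtain ⟨w, hl, hw, hg⟩ := exists_word_length hX g
  have := wordLength_le_of X (w.map (·⁻¹)).reverse (by
    intro a ha
    simp only [List.mem_reverse, List.mem_map] at ha
    obtain ⟨b, hb, rfl⟩ := ha
    simpa using (hw b hb).symm)
  rw [← List.prod_inv_reverse, hg] at this
  simpa [hl] using this

theorem hom_wordLength_le {G H : Type*} [Group G] [Group H] {X : Finset G} {Y : Finset H}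
    (hX : Generates X) (hY : Generates Y) (φ : G →* H) :
    ∃ B : ℕ, ∀ g, wordLength Y (φ g) ≤ B * wordLength X g := by
  refine ⟨X.sup (fun x => wordLength Y (φ x)), fun g => ?_⟩
  set B := X.sup (fun x => wordLength Y (φ x)) with hB
  have key : ∀ w : List G, (∀ a ∈ w, a ∈ X ∨ a⁻¹ ∈ X) →
      wordLength Y (φ w.prod) ≤ B * w.length := by
    intro w
    induction w with
    | nil => intro _; simp [wordLength_one]
    | cons a w ih =>
      intro hw
      have h1 := ih fun b hb => hw b (by simp [hb])
      have h2 : wordLength Y (φ a) ≤ B := by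
        rcases hw a (by simp) with h | h
        · exact Finset.le_sup (f := fun x => wordLength Y (φ x)) h
        · have h3 : wordLength Y (φ a⁻¹) ≤ B := Finset.le_sup (f := fun x => wordLength Y (φ x)) h
          have h4 := wordLength_inv_le hY (φ a⁻¹)
          simp only [map_inv, inv_inv] at h3 h4
          omega
      have h3 := wordLength_mul_le hY (φ a) (φ w.prod)
      simp only [List.prod_cons, map_mul, List.length_cons]
      calc _ ≤ _ := h3
        _ ≤ B + B * w.length := by omega
        _ = _ := by ring
  obtain ⟨w, hl, hw, hg⟩ := exists_word_length hX g
  have := key w hw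
  rwa [hg, hl] at this

/-- A potential function with finitely many jumps over each generator bounds distortion. -/
theorem qi_of_potential {G H Ω : Type*} [Group G] [Group H] [MulAction H Ω]
    {X : Finset G} {Y : Finset H} (hX : Generates X) (hY : Generates Y) (φ : G →* H)
    (pot : Ω → G) (F : Set G) (hF : F.Finite)
    (hpot : ∀ y ∈ Y, ∀ p, pot (y • p) * (pot p)⁻¹ ∈ F)
    (p0 : Ω) (hp0 : ∀ g, pot (φ g • p0) = g * pot p0) : IsQIEmbedding X Y φ := by
  obtain ⟨B1, hB1⟩ := hom_wordLength_le hX hY φ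
  set B := hF.toFinset.sup (wordLength X) with hB
  have hjump : ∀ a : H, (a ∈ Y ∨ a⁻¹ ∈ Y) → ∀ p, wordLength X (pot (a • p) * (pot p)⁻¹) ≤ B := by
    intro a ha p
    rcases ha with h | h
    · exact Finset.le_sup (f := wordLength X) (by simpa using hpot a h p)
    · have h1 : wordLength X (pot (a⁻¹ • a • p) * (pot (a • p))⁻¹) ≤ B :=
        Finset.le_sup (f := wordLength X) (by simpa using hpot _ h (a • p))
      have h2 := wordLength_inv_le hX (pot (a⁻¹ • a • p) * (pot (a • p))⁻¹)
      simp only [inv_smul_smul, mul_inv_rev, inv_inv] at h1 h2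
      omega
  have key : ∀ w : List H, (∀ a ∈ w, a ∈ Y ∨ a⁻¹ ∈ Y) → ∀ p,
      wordLength X (pot (w.prod • p) * (pot p)⁻¹) ≤ B * w.length := by
    intro w
    induction w with
    | nil => intro _ p; simp [wordLength_one]
    | cons a w ih =>
      intro hw p
      have h1 := ih (fun b hb => hw b (by simp [hb])) p
      have h2 := hjump a (hw a (by simp)) (w.prod • p)
      have h3 := wordLength_mul_le hX (pot (a • w.prod • p) * (pot (w.prod • p))⁻¹)
        (pot (w.prod • p) * (pot p)⁻¹)
      simp only [List.prod_cons, mul_smul, List.length_cons]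
      have h4 : pot (a • w.prod • p) * (pot (w.prod • p))⁻¹ * (pot (w.prod • p) * (pot p)⁻¹)
          = pot (a • w.prod • p) * (pot p)⁻¹ := by group
      rw [h4] at h3
      calc _ ≤ _ := h3
        _ ≤ B + B * w.length := by omega
        _ = _ := by ring
  have hlow : ∀ g, wordLength X g ≤ B * wordLength Y (φ g) := by
    intro g
    obtain ⟨w, hl, hw, hg⟩ := exists_word_length hY (φ g)
    have := key w hw p0
    rw [hg, hl, hp0] at this
    simpa using this
  refine ⟨?_, (B + B1 + 1 : ℕ), 1, by positivity, one_pos, fun g => ⟨?_, ?_⟩⟩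
  · intro a b hab
    have h1 := hp0 a
    rw [hab, hp0 b] at h1
    exact (mul_right_cancel h1).symm
  · have h1 : (wordLength X g : ℝ) ≤ (B + B1 + 1 : ℕ) * (wordLength Y (φ g) : ℝ) := by
      have : wordLength X g ≤ (B + B1 + 1) * wordLength Y (φ g) :=
        (hlow g).trans (Nat.mul_le_mul_right _ (by omega))
      exact_mod_cast this
    have h2 : (0 : ℝ) < (B + B1 + 1 : ℕ) := by positivity
    have h3 : 1 / ((B + B1 + 1 : ℕ) : ℝ) * (wordLength X g : ℝ) ≤ wordLength Y (φ g) := by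
      rw [one_div, inv_mul_le_iff₀ h2]; exact h1
    linarith
  · have h1 : (wordLength Y (φ g) : ℝ) ≤ (B + B1 + 1 : ℕ) * (wordLength X g : ℝ) := by
      have : wordLength Y (φ g) ≤ (B + B1 + 1) * wordLength X g :=
        (hB1 g).trans (Nat.mul_le_mul_right _ (by omega))
      exact_mod_cast this
    linarith

theorem qi_comp {G L H : Type*} [Group G] [Group L] [Group H] {X : Finset G} {Z : Finset L}
    {Y : Finset H} {φ : G →* L} {ψ : L →* H} (h1 : IsQIEmbedding X Z φ)
    (h2 : IsQIEmbedding Z Y ψ) : IsQIEmbedding X Y (ψ.comp φ) := by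
  obtain ⟨i1, C1, k1, hC1, hk1, h1⟩ := h1
  obtain ⟨i2, C2, k2, hC2, hk2, h2⟩ := h2
  refine ⟨i2.comp i1, C1 * C2, C2 * k1 + k1 / C2 + k2, by positivity, by positivity, fun g => ?_⟩
  obtain ⟨a1, b1⟩ := h1 g
  obtain ⟨a2, b2⟩ := h2 (φ g)
  simp only [MonoidHom.comp_apply]
  constructor
  · have : 1 / C2 * (1 / C1 * (wordLength X g : ℝ) - k1) ≤ 1 / C2 * (wordLength Z (φ g) : ℝ) := by
      gcongr
    have e : 1 / C2 * (1 / C1 * (wordLength X g : ℝ) - k1)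
        = 1 / (C1 * C2) * (wordLength X g : ℝ) - k1 / C2 := by field_simp
    have : 0 < C2 * k1 := by positivity
    linarith
  · have : C2 * (wordLength Z (φ g) : ℝ) ≤ C2 * (C1 * wordLength X g + k1) := by gcongr
    have e : 0 < k1 / C2 := by positivity
    nlinarith

theorem frattini_comp {G L H : Type*} [Group G] [Group L] [Group H] {φ : G →* L} {ψ : L →* H}
    (h1 : IsFrattini φ) (h2 : IsFrattini ψ) : IsFrattini (ψ.comp φ) :=
  ⟨h2.1.comp h1.1, fun a b => (h1.2 a b).trans (h2.2 _ _)⟩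

theorem frattini_of {G H : Type*} [Group G] [Group H] {φ : G →* H} (hi : Function.Injective φ)
    (h : ∀ (a b : G) (c : H), c * φ a = φ b * c → IsConj a b) : IsFrattini φ := by
  refine ⟨hi, fun a b => ⟨fun hab => ?_, fun hab => ?_⟩⟩
  · exact MonoidHom.map_isConj φ hab
  · obtain ⟨c, hc⟩ := isConj_iff.1 hab
    exact h a b c (by rw [← hc]; group)

end QIpart


section Comp

variable {α β σ : Type*} [Primcodable α] [Primcodable β] [Primcodable σ]

theorem comp_foldl {f : α → List β} {g : α → σ} {h : α → σ × β → σ}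
    (hf : Computable f) (hg : Computable g) (hh : Computable₂ h) :
    Computable fun a => (f a).foldl (fun s b => h a (s, b)) (g a) := by
  have key : Computable fun a => Nat.rec (motive := fun _ => σ) (g a)
      (fun k s => Option.casesOn (motive := fun _ => σ) ((f a)[k]?) s (fun b => h a (s, b))) (f a).length := by
    refine Computable.nat_rec (Computable.list_length.comp hf) hg
      (h := fun a p => Option.casesOn (motive := fun _ => σ) ((f a)[p.1]?) p.2 (fun b => h a (p.2, b))) ?_
    refine Computable.option_casesOn (Computable.list_getElem?.comp (hf.comp Computable.fst)
      (Computable.fst.comp Computable.snd)) (Computable.snd.comp Computable.snd) ?_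
    exact hh.comp (Computable.fst.comp Computable.fst)
      (Computable.pair (Computable.snd.comp (Computable.snd.comp Computable.fst)) Computable.snd)
  refine key.of_eq fun a => ?_
  have : ∀ l : List β, ∀ k, k ≤ l.length → (Nat.rec (motive := fun _ => σ) (g a)
      (fun k s => Option.casesOn (motive := fun _ => σ) (l[k]?) s (fun b => h a (s, b))) k : σ)
      = (l.take k).foldl (fun s b => h a (s, b)) (g a) := by
    intro l k
    induction k with
    | zero => intro _; simp
    | succ k ih =>
      intro hk
      have hk' : k < l.length := hk
      have h1 : l[k]? = some l[k] := List.getElem?_eq_getElem hk'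
      have h2 := ih hk'.le
      simp only [h2, h1]
      rw [List.take_add_one, h1, List.foldl_append]
      rfl
  simpa using this (f a) _ le_rfl

theorem comp_foldr {f : α → List β} {g : α → σ} {h : α → β × σ → σ}
    (hf : Computable f) (hg : Computable g) (hh : Computable₂ h) :
    Computable fun a => (f a).foldr (fun b s => h a (b, s)) (g a) := by
  refine (comp_foldl (Computable.list_reverse.comp hf) hg (h := fun a p => h a (p.2, p.1)) ?_).of_eq ?_
  · exact hh.comp Computable.fst (Computable.pair (Computable.snd.comp Computable.snd)
      (Computable.fst.comp Computable.snd))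
  · intro a; simp

theorem comp_all {f : α → List β} {p : α → β → Bool} (hf : Computable f) (hp : Computable₂ p) :
    Computable fun a => (f a).all (p a) := by
  refine (comp_foldr hf (Computable.const true) (h := fun a q => cond (p a q.1) q.2 false) ?_).of_eq ?_
  · exact Computable.cond (hp.comp Computable.fst (Computable.fst.comp Computable.snd))
      (Computable.snd.comp Computable.snd) (Computable.const false)
  · intro a
    induction f a with
    | nil => simp
    | cons b l ih => cases h : p a b <;> simp_all

theorem comp_map {f : α → List β} {g : α → β → σ} (hf : Computable f) (hg : Computable₂ g) :
    Computable fun a => (f a).map (g a) := by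
  refine (comp_foldr hf (Computable.const []) (h := fun a q => g a q.1 :: q.2) ?_).of_eq ?_
  · exact Computable.list_cons.comp (hg.comp Computable.fst (Computable.fst.comp Computable.snd))
      (Computable.snd.comp Computable.snd)
  · intro a
    induction f a with
    | nil => simp
    | cons b l ih => simp_all

theorem comp_filter {f : α → List β} {p : α → β → Bool} (hf : Computable f) (hp : Computable₂ p) :
    Computable fun a => (f a).filter (p a) := by
  refine (comp_foldr hf (Computable.const []) (h := fun a q => cond (p a q.1) (q.1 :: q.2) q.2) ?_).of_eq ?_
  · exact Computable.cond (hp.comp Computable.fst (Computable.fst.comp Computable.snd))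
      (Computable.list_cons.comp (Computable.fst.comp Computable.snd) (Computable.snd.comp Computable.snd))
      (Computable.snd.comp Computable.snd)
  · intro a
    induction f a with
    | nil => simp
    | cons b l ih => cases h : p a b <;> simp_all

theorem comp_and {p q : α → Bool} (hp : Computable p) (hq : Computable q) :
    Computable fun a => p a && q a :=
  (Computable.cond hp hq (Computable.const false)).of_eq fun a => by cases p a <;> rfl

/-- all lists over `A` of length at most `n`. -/
def enumLists {β : Type*} (A : List β) : ℕ → List (List β)
  | 0 => [[]]
  | n + 1 => [] :: (enumLists A n).flatMap (fun l => A.map (fun b => b :: l))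

theorem mem_enumLists {β : Type*} (A : List β) (n : ℕ) (l : List β) :
    l ∈ enumLists A n ↔ l.length ≤ n ∧ ∀ b ∈ l, b ∈ A := by
  induction n generalizing l with
  | zero => 
    simp only [enumLists, List.mem_singleton, Nat.le_zero, List.length_eq_zero_iff]
    constructor
    · rintro rfl; simp
    · exact fun h => h.1
  | succ n ih =>
    cases l with
    | nil => simp [enumLists]
    | cons b l =>
      simp only [enumLists, List.mem_cons, List.mem_flatMap, List.mem_map, ih]
      constructor
      · rintro (h | ⟨l', h, b', hb, h2⟩)
        · cases h
        · cases h2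
          refine ⟨by simpa using h.1, ?_⟩
          rintro c (rfl | hc)
          · exact hb
          · exact h.2 c hc
      · rintro ⟨h1, h2⟩
        exact Or.inr ⟨l, ⟨by simpa using h1, fun c hc => h2 c (Or.inr hc)⟩, b, h2 b (Or.inl rfl), rfl⟩

theorem primrec_enumLists : Primrec₂ (enumLists : List β → ℕ → List (List β)) := by
  have key : Primrec fun q : List β × ℕ => Nat.rec (motive := fun _ => List (List β)) [[]]
      (fun _ s => [] :: s.flatMap (fun l => q.1.map (fun b => b :: l))) q.2 := by
    refine Primrec.nat_rec' Primrec.snd (Primrec.const _)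
      (h := fun (q : List β × ℕ) (r : ℕ × List (List β)) =>
        [] :: r.2.flatMap (fun l => q.1.map (fun b => b :: l))) ?_
    refine Primrec.list_cons.comp (Primrec.const []) ?_
    refine Primrec.list_flatMap (Primrec.snd.comp Primrec.snd) ?_
    refine Primrec.list_map (Primrec.fst.comp (Primrec.fst.comp Primrec.fst)) ?_
    exact Primrec.list_cons.comp Primrec.snd (Primrec.snd.comp Primrec.fst)
  refine (key.of_eq fun q => ?_)
  rcases q with ⟨A, n⟩
  simp only
  induction n with
  | zero => rfl
  | succ n ih => simp only [enumLists, ← ih]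

theorem computable_of_pred {p : α → Prop} (f : α → Bool) (hf : Computable f)
    (h : ∀ a, f a = true ↔ p a) : ComputablePred p := by
  rw [ComputablePred.computable_iff]
  exact ⟨f, hf, by funext a; exact propext (h a).symm⟩

theorem pred_to_bool {p : α → Prop} (hp : ComputablePred p) :
    ∃ f : α → Bool, Computable f ∧ ∀ a, f a = true ↔ p a := by
  obtain ⟨f, hf, rfl⟩ := ComputablePred.computable_iff.1 hp
  exact ⟨f, hf, fun a => Iff.rfl⟩

end Comp


section Streams

/-- incomparable words -/
def Inc (u v : List Bool) : Prop := ¬ u <+: v ∧ ¬ v <+: u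

instance (u v : List Bool) : Decidable (Inc u v) := by unfold Inc; infer_instance

theorem Inc.symm {u v : List Bool} (h : Inc u v) : Inc v u := ⟨h.2, h.1⟩

/-- cone membership -/
def InC (u : List Bool) (c : Stream' Bool) : Prop := ∃ z, c = u ++ₛ z

theorem take_app (u : List Bool) (z : Stream' Bool) : (u ++ₛ z).take u.length = u := by
  rw [Stream'.take_append_of_le_length _ _ _ le_rfl]; simp

theorem inC_iff (u : List Bool) (c : Stream' Bool) : InC u c ↔ c.take u.length = u := by
  constructor
  · rintro ⟨z, rfl⟩; exact take_app u z
  · intro h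
    refine ⟨c.drop u.length, ?_⟩
    conv_lhs => rw [← Stream'.append_take_drop u.length c, h]

theorem app_inj {u : List Bool} {z z' : Stream' Bool} (h : u ++ₛ z = u ++ₛ z') : z = z' := by
  have := congrArg (Stream'.drop u.length) h
  simpa [Stream'.drop_append_stream] using this

theorem prefix_of_app {u v : List Bool} {z z' : Stream' Bool} (h : u ++ₛ z = v ++ₛ z')
    (hl : u.length ≤ v.length) : u <+: v := by
  have h1 := congrArg (Stream'.take u.length) h
  rw [take_app, Stream'.take_append_of_le_length _ _ _ hl] at h1
  rw [h1]; exact ⟨_, List.take_append_drop _ _⟩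

theorem app_len_inj {u v : List Bool} {z z' : Stream' Bool} (h : u ++ₛ z = v ++ₛ z')
    (hl : u.length = v.length) : u = v ∧ z = z' := by
  have h1 : u = v := (prefix_of_app h hl.le).eq_of_length hl
  subst h1
  exact ⟨rfl, app_inj h⟩

theorem Inc.ne {u v : List Bool} (h : Inc u v) (z z' : Stream' Bool) : u ++ₛ z ≠ v ++ₛ z' := by
  intro e
  rcases le_total u.length v.length with hl | hl
  · exact h.1 (prefix_of_app e hl)
  · exact h.2 (prefix_of_app e.symm hl)

theorem Inc.not {u v : List Bool} (h : Inc u v) (z : Stream' Bool) : ¬ InC u (v ++ₛ z) :=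
  fun ⟨_, h'⟩ => h.symm.ne _ _ h'

theorem prefix_total {u v w : List Bool} (h1 : u <+: w) (h2 : v <+: w) : u <+: v ∨ v <+: u := by
  rcases le_total u.length v.length with h | h
  · exact Or.inl (List.prefix_of_prefix_length_le h1 h2 h)
  · exact Or.inr (List.prefix_of_prefix_length_le h2 h1 h)

theorem Inc.extend_both {u v a b : List Bool} (h : Inc u v) (h1 : u <+: a) (h2 : v <+: b) : Inc a b := by
  obtain ⟨a', rfl⟩ := h1
  obtain ⟨b', rfl⟩ := h2
  constructor
  · rintro hp
    have h3 : u <+: v ++ b' := (List.prefix_append _ _).trans hp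
    rcases prefix_total h3 (List.prefix_append _ _) with h4 | h4
    · exact h.1 h4
    · exact h.2 h4
  · rintro hp
    have h3 : v <+: u ++ a' := (List.prefix_append _ _).trans hp
    rcases prefix_total h3 (List.prefix_append _ _) with h4 | h4
    · exact h.2 h4
    · exact h.1 h4

/-- prefix exchange on streams -/
def swS (u v : List Bool) (c : Stream' Bool) : Stream' Bool :=
  if c.take u.length = u then v ++ₛ c.drop u.length
  else if c.take v.length = v then u ++ₛ c.drop v.length else c

/-- prefix exchange on finite words -/
def swL (u v : List Bool) (a : List Bool) : List Bool :=
  if a.take u.length = u then v ++ a.drop u.length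
  else if a.take v.length = v then u ++ a.drop v.length else a

theorem swS_left (u v : List Bool) (z : Stream' Bool) : swS u v (u ++ₛ z) = v ++ₛ z := by
  rw [swS, if_pos (take_app u z), Stream'.drop_append_stream]

theorem swS_right {u v : List Bool} (h : Inc u v) (z : Stream' Bool) :
    swS u v (v ++ₛ z) = u ++ₛ z := by
  rw [swS, if_neg, if_pos (take_app v z), Stream'.drop_append_stream]
  rw [← inC_iff]; exact h.not z

theorem swS_else {u v : List Bool} {c : Stream' Bool} (h1 : ¬ InC u c) (h2 : ¬ InC v c) :
    swS u v c = c := by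
  rw [inC_iff] at h1 h2
  rw [swS, if_neg h1, if_neg h2]

theorem swS_inv {u v : List Bool} (h : Inc u v) (c : Stream' Bool) : swS u v (swS u v c) = c := by
  by_cases h1 : InC u c
  · obtain ⟨z, rfl⟩ := h1
    rw [swS_left, swS_right h]
  by_cases h2 : InC v c
  · obtain ⟨z, rfl⟩ := h2
    rw [swS_right h, swS_left]
  rw [swS_else h1 h2, swS_else h1 h2]

theorem swS_app {u v a : List Bool} (h1 : u.length ≤ a.length) (h2 : v.length ≤ a.length)
    (z : Stream' Bool) : swS u v (a ++ₛ z) = swL u v a ++ₛ z := by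
  unfold swS swL
  have hd : ∀ n ≤ a.length, (a ++ₛ z).drop n = a.drop n ++ₛ z := by
    intro n hn
    conv_lhs => rw [← List.take_append_drop n a, Stream'.append_append_stream]
    have : n = (a.take n).length := by simp [hn]
    conv_lhs => arg 1; rw [this]
    rw [Stream'.drop_append_stream]
  rw [Stream'.take_append_of_le_length _ _ _ h1, Stream'.take_append_of_le_length _ _ _ h2, hd _ h1, hd _ h2]
  split_ifs <;> simp

theorem swL_length {u v a : List Bool} (hu : u.length = 2 ∨ u.length = 3)
    (hv : v.length = 2 ∨ v.length = 3) :
    a.length ≤ (swL u v a).length + 1 := by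
  unfold swL
  split_ifs with h1 h2
  · have := congrArg List.length h1; simp at this; simp; omega
  · have := congrArg List.length h2; simp at this; simp; omega
  · omega

theorem stream_split2 (c : Stream' Bool) : ∃ (i j : Bool) (z : Stream' Bool), c = [i, j] ++ₛ z :=
  ⟨c.head, c.tail.head, c.tail.tail, by
    conv_lhs => rw [← Stream'.eta c, ← Stream'.eta c.tail]
    rfl⟩

theorem stream_split (n : ℕ) (c : Stream' Bool) : ∃ (a : List Bool) (z : Stream' Bool),
    a.length = n ∧ c = a ++ₛ z :=
  ⟨c.take n, c.drop n, by simp, by simp⟩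

end Streams

section Perms

variable {L : Type} [Group L]

/-- the space acted on -/
abbrev Om (L : Type) := Stream' Bool × List L

/-- act on the head -/
def labH (g : L) : List L → List L
  | [] => []
  | s :: t => (g * s) :: t

theorem labH_one (x : List L) : labH 1 x = x := by cases x <;> simp [labH]

theorem labH_mul (g h : L) (x : List L) : labH (g * h) x = labH g (labH h x) := by
  cases x <;> simp [labH, mul_assoc]

/-- swaps -/
def sig (L : Type) (u v : List Bool) : Equiv.Perm (Om L) :=
  if h : Inc u v then Function.Involutive.toPerm (fun p : Om L => (swS u v p.1, p.2))
    (fun p => by simp [swS_inv h]) else 1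

theorem sig_apply {u v : List Bool} (h : Inc u v) (c : Stream' Bool) (x : List L) :
    sig L u v (c, x) = (swS u v c, x) := by
  simp only [sig, h, dif_pos]; rfl

theorem sig_left {u v : List Bool} (h : Inc u v) (z : Stream' Bool) (x : List L) :
    sig L u v (u ++ₛ z, x) = (v ++ₛ z, x) := by rw [sig_apply h, swS_left]

theorem sig_right {u v : List Bool} (h : Inc u v) (z : Stream' Bool) (x : List L) :
    sig L u v (v ++ₛ z, x) = (u ++ₛ z, x) := by rw [sig_apply h, swS_right h]

theorem sig_else {u v : List Bool} {c : Stream' Bool} (h1 : ¬ InC u c) (h2 : ¬ InC v c)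
    (x : List L) : sig L u v (c, x) = (c, x) := by
  by_cases h : Inc u v
  · rw [sig_apply h, swS_else h1 h2]
  · simp [sig, h]

theorem sig_fix {u v w : List Bool} (h1 : Inc u w) (h2 : Inc v w) (z : Stream' Bool) 
    (x : List L) : sig L u v (w ++ₛ z, x) = (w ++ₛ z, x) := sig_else (h1.not z) (h2.not z) x

theorem sig_mul_self (u v : List Bool) : sig L u v * sig L u v = 1 := by
  by_cases h : Inc u v
  · ext1 p; obtain ⟨c, x⟩ := p; simp [sig_apply h, swS_inv h]
  · simp [sig, h]

theorem sig_inv (u v : List Bool) : (sig L u v)⁻¹ = sig L u v :=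
  inv_eq_of_mul_eq_one_left (sig_mul_self u v)

theorem sig_comm (u v : List Bool) : sig L u v = sig L v u := by
  by_cases h : Inc u v
  · ext1 p; obtain ⟨c, x⟩ := p
    by_cases h1 : InC u c
    · obtain ⟨z, rfl⟩ := h1
      rw [sig_left h, sig_right h.symm]
    by_cases h2 : InC v c
    · obtain ⟨z, rfl⟩ := h2
      rw [sig_right h, sig_left h.symm]
    rw [sig_else h1 h2, sig_else h2 h1]
  · have : ¬ Inc v u := fun h' => h h'.symm
    simp [sig, h, this]

open Classical in
/-- the involution -/
noncomputable def iotaF (p : Om L) : Om L :=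
  if p.1.take 2 = [false, true] then ([false, false] ++ₛ p.1.drop 2, 1 :: p.2)
  else if p.1.take 2 = [false, false] then
    (if p.2.head? = some 1 then ([false, true] ++ₛ p.1.drop 2, p.2.tail) else p)
  else p

theorem take2 (i j : Bool) (z : Stream' Bool) : ([i, j] ++ₛ z).take 2 = [i, j] := take_app [i, j] z
theorem drop2 (i j : Bool) (z : Stream' Bool) : ([i, j] ++ₛ z).drop 2 = z :=
  Stream'.drop_append_stream [i, j] z

theorem iotaF_01 (z : Stream' Bool) (x : List L) :
    iotaF ([false, true] ++ₛ z, x) = ([false, false] ++ₛ z, 1 :: x) := by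
  simp only [iotaF, take2, drop2]; simp

theorem iotaF_001 (z : Stream' Bool) (x : List L) :
    iotaF ([false, false] ++ₛ z, 1 :: x) = ([false, true] ++ₛ z, x) := by
  simp only [iotaF, take2, drop2]; simp

theorem iotaF_00 (z : Stream' Bool) (x : List L) (h : x.head? ≠ some 1) :
    iotaF ([false, false] ++ₛ z, x) = ([false, false] ++ₛ z, x) := by
  simp only [iotaF, take2, drop2]; simp [h]

theorem iotaF_1 (j : Bool) (z : Stream' Bool) (x : List L) :
    iotaF ([true, j] ++ₛ z, x) = ([true, j] ++ₛ z, x) := by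
  simp only [iotaF, take2, drop2]; simp

theorem iotaF_inv : Function.Involutive (iotaF : Om L → Om L) := by
  rintro ⟨c, x⟩
  obtain ⟨i, j, z, rfl⟩ := stream_split2 c
  cases i with
  | true => rw [iotaF_1, iotaF_1]
  | false =>
    cases j with
    | true => rw [iotaF_01, iotaF_001]
    | false =>
      by_cases h : x.head? = some 1
      · cases x with
        | nil => simp at h
        | cons s t =>
          have : s = 1 := by simpa using h
          subst this
          rw [iotaF_001, iotaF_01]
      · rw [iotaF_00 _ _ h, iotaF_00 _ _ h]

/-- the involution as a permutation -/
noncomputable def iota (L : Type) [Group L] : Equiv.Perm (Om L) := iotaF_inv.toPerm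

theorem iota_01 (z : Stream' Bool) (x : List L) :
    iota L ([false, true] ++ₛ z, x) = ([false, false] ++ₛ z, 1 :: x) := iotaF_01 z x

theorem iota_001 (z : Stream' Bool) (x : List L) :
    iota L ([false, false] ++ₛ z, 1 :: x) = ([false, true] ++ₛ z, x) := iotaF_001 z x

theorem iota_00 (z : Stream' Bool) (x : List L) (h : x.head? ≠ some 1) :
    iota L ([false, false] ++ₛ z, x) = ([false, false] ++ₛ z, x) := iotaF_00 z x h

theorem iota_1 (j : Bool) (z : Stream' Bool) (x : List L) :
    iota L ([true, j] ++ₛ z, x) = ([true, j] ++ₛ z, x) := iotaF_1 j z x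

theorem iota_mul_self : iota L * iota L = 1 := by
  ext1 p; exact iotaF_inv p

theorem iota_inv : (iota L)⁻¹ = iota L := inv_eq_of_mul_eq_one_left iota_mul_self

/-- labels -/
def labF (g : L) (p : Om L) : Om L :=
  if p.1.take 2 = [false, false] then (p.1, labH g p.2) else p

theorem labF_00 (g : L) (z : Stream' Bool) (x : List L) :
    labF g ([false, false] ++ₛ z, x) = ([false, false] ++ₛ z, labH g x) := by
  simp only [labF, take2]; simp

theorem labF_else (g : L) (i j : Bool) (h : [i, j] ≠ [false, false]) (z : Stream' Bool) (x : List L) :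
    labF g ([i, j] ++ₛ z, x) = ([i, j] ++ₛ z, x) := by
  simp only [labF, take2, if_neg h]

theorem labF_mul (g h : L) (p : Om L) : labF (g * h) p = labF g (labF h p) := by
  obtain ⟨c, x⟩ := p
  obtain ⟨i, j, z, rfl⟩ := stream_split2 c
  by_cases e : [i, j] = [false, false]
  · rw [e, labF_00, labF_00, labF_00, labH_mul]
  · rw [labF_else _ _ _ e, labF_else _ _ _ e, labF_else _ _ _ e]

theorem labF_one (p : Om L) : labF 1 p = p := by
  simp [labF, labH_one]

/-- labels as permutations -/
def lab : L →* Equiv.Perm (Om L) where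
  toFun g := ⟨labF g, labF g⁻¹, fun p => by rw [← labF_mul]; simp [labF_one],
    fun p => by rw [← labF_mul]; simp [labF_one]⟩
  map_one' := by ext1 p; exact labF_one p
  map_mul' g h := by ext1 p; exact labF_mul g h p

theorem lab_00 (g : L) (z : Stream' Bool) (x : List L) :
    lab g ([false, false] ++ₛ z, x) = ([false, false] ++ₛ z, labH g x) := labF_00 g z x

theorem lab_else (g : L) (i j : Bool) (h : [i, j] ≠ [false, false]) (z : Stream' Bool) (x : List L) :
    lab g ([i, j] ++ₛ z, x) = ([i, j] ++ₛ z, x) := labF_else g i j h z x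

end Perms


section Sim

/-- words over the generators -/
abbrev LW (m : ℕ) := List (Fin m × Bool)

/-- step codes -/
abbrev SC (m : ℕ) := (List Bool × List Bool) ⊕ (Unit ⊕ (Fin m × Bool))

/-- symbolic states -/
abbrev SSt (m : ℕ) := List Bool × (List (LW m) × LW m)

variable {L : Type} [Group L] {m : ℕ} (ρ : FreeGroup (Fin m) →* L)

/-- evaluation -/
def ev (w : LW m) : L := ρ (FreeGroup.mk w)

theorem ev_nil : ev ρ [] = 1 := by
  rw [ev, ← FreeGroup.one_eq_mk, map_one]

theorem ev_append (w w' : LW m) : ev ρ (w ++ w') = ev ρ w * ev ρ w' := by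
  rw [ev, ev, ev, ← FreeGroup.mul_mk, map_mul]

theorem ev_cons (p : Fin m × Bool) (w : LW m) : ev ρ (p :: w) = ev ρ [p] * ev ρ w :=
  ev_append ρ [p] w

theorem ev_neg (p : Fin m × Bool) : ev ρ [(p.1, !p.2)] = (ev ρ [p])⁻¹ := by
  rw [ev, ev, ← map_inv, FreeGroup.inv_mk]; rfl

/-- real action of a code -/
noncomputable def act : SC m → Equiv.Perm (Om L)
  | Sum.inl q => sig L q.1 q.2
  | Sum.inr (Sum.inl _) => iota L
  | Sum.inr (Sum.inr p) => lab (ev ρ [p])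

/-- inverse code -/
def invSC : SC m → SC m
  | Sum.inl q => Sum.inl q
  | Sum.inr (Sum.inl u) => Sum.inr (Sum.inl u)
  | Sum.inr (Sum.inr p) => Sum.inr (Sum.inr (p.1, !p.2))

theorem act_invSC (s : SC m) : act ρ (invSC s) = (act ρ s)⁻¹ := by
  rcases s with q | u | p
  · exact (sig_inv _ _).symm
  · exact iota_inv.symm
  · simp only [invSC, act, ev_neg, map_inv]

/-- admissible codes -/
def GoodSC : SC m → Prop
  | Sum.inl q => Inc q.1 q.2 ∧ (q.1.length = 2 ∨ q.1.length = 3) ∧ (q.2.length = 2 ∨ q.2.length = 3)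
  | Sum.inr _ => True

theorem GoodSC.inv {s : SC m} (h : GoodSC s) : GoodSC (invSC s) := by
  rcases s with q | u | p
  · exact h
  · trivial
  · trivial

variable (dw : LW m → Bool)

/-- symbolic iota -/
def stepI (st : SSt m) : SSt m :=
  if st.1.take 2 = [false, true] then (false :: false :: st.1.drop 2, [] :: st.2.1, st.2.2)
  else if st.1.take 2 = [false, false] then
    if st.2.1 = [] then st else
    if dw st.2.1.headI = true then (false :: true :: st.1.drop 2, st.2.1.tail, st.2.2) else st
  else st

/-- symbolic label -/
def stepP (p : Fin m × Bool) (st : SSt m) : SSt m :=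
  if st.1.take 2 = [false, false] then
    if st.2.1 = [] then (st.1, [], p :: st.2.2)
    else (st.1, (p :: st.2.1.headI) :: st.2.1.tail, st.2.2)
  else st

/-- symbolic step -/
def step : SC m → SSt m → SSt m
  | Sum.inl q, st => (swL q.1 q.2 st.1, st.2)
  | Sum.inr (Sum.inl _), st => stepI dw st
  | Sum.inr (Sum.inr p), st => stepP p st

/-- simulation -/
def sim (W : List (SC m)) (st : SSt m) : SSt m := W.foldr (step dw) st

/-- meaning of a symbolic state -/
def real (st : SSt m) (z : Stream' Bool) (rest : List L) : Om L :=
  (st.1 ++ₛ z, st.2.1.map (ev ρ) ++ labH (ev ρ st.2.2) rest)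

/-- genericity condition -/
def Cond (n : ℕ) (u : List (LW m)) (g : LW m) (rest : List L) : Prop :=
  rest = [] ∨ n ≤ u.length ∨
    ∃ s t, rest = s :: t ∧ ∀ w : LW m, w.length ≤ n → ev ρ w * (ev ρ g * s) ≠ 1

theorem Cond.mono {n k : ℕ} {u : List (LW m)} {g : LW m} {rest : List L} (h : Cond ρ n u g rest)
    (hk : k ≤ n) : Cond ρ k u g rest := by
  rcases h with h | h | ⟨s, t, h, h'⟩
  · exact Or.inl h
  · exact Or.inr (Or.inl (hk.trans h))
  · exact Or.inr (Or.inr ⟨s, t, h, fun w hw => h' w (hw.trans hk)⟩)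

variable {dw}


theorem step_real (hdw : ∀ w, dw w = true ↔ ev ρ w = 1) {s : SC m} (hs : GoodSC s) {n : ℕ} {st : SSt m} {rest : List L}
    (ha : n + 3 ≤ st.1.length) (hc : Cond ρ (n + 1) st.2.1 st.2.2 rest) :
    (∀ z, act ρ s (real ρ st z rest) = real ρ (step dw s st) z rest) ∧
      n + 2 ≤ (step dw s st).1.length ∧
      Cond ρ n (step dw s st).2.1 (step dw s st).2.2 rest := by
  obtain ⟨a, u, g⟩ := st
  rcases s with q | w | p
  · obtain ⟨h1, h2, h3⟩ := hs
    refine ⟨fun z => ?_, ?_, hc.mono ρ (by omega)⟩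
    · simp only [act, real, step]
      rw [sig_apply h1, swS_app]
      · simp only at ha; omega
      · simp only at ha; omega
    · have := swL_length (a := a) h2 h3
      simp only [step] at *
      omega
  · rcases a with _ | ⟨i, _ | ⟨j, a⟩⟩
    · simp at ha
    · simp at ha
    have hreal : ∀ (i j : Bool) (u : List (LW m)) (z : Stream' Bool), real ρ (i :: j :: a, u, g) z rest =
      ([i, j] ++ₛ (a ++ₛ z), u.map (ev ρ) ++ labH (ev ρ g) rest) := fun i j u z => rfl
    simp only [step, act]
    cases i with
    | true =>
      have e : stepI dw (true :: j :: a, u, g) = (true :: j :: a, u, g) := by simp [stepI]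
      rw [e]
      refine ⟨fun z => ?_, by simpa using by simp at ha; omega, hc.mono ρ (by omega)⟩
      rw [hreal, iota_1]
    | false =>
      cases j with
      | true =>
        have e : stepI dw (false :: true :: a, u, g) = (false :: false :: a, [] :: u, g) := by
          simp [stepI]
        rw [e]
        refine ⟨fun z => ?_, by simpa using by simp at ha; omega, ?_⟩
        · rw [hreal, iota_01, hreal]; simp [ev_nil]
        · rcases hc with h | h | ⟨s, t, h, h'⟩
          · exact Or.inl h
          · exact Or.inr (Or.inl (by simp at h ⊢; omega))
          · exact Or.inr (Or.inr ⟨s, t, h, fun w hw => h' w (by omega)⟩)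
      | false =>
        cases u with
        | nil =>
          have e : stepI dw (false :: false :: a, [], g) = (false :: false :: a, [], g) := by
            simp [stepI]
          rw [e]
          refine ⟨fun z => ?_, by simpa using by simp at ha; omega, hc.mono ρ (by omega)⟩
          rw [hreal, iota_00]
          rcases hc with h | h | ⟨s, t, h, h'⟩
          · subst h; simp [labH]
          · simp at h
          · subst h
            have := h' [] (by simp)
            rw [ev_nil, one_mul] at this
            simpa [labH] using this
        | cons s u =>
          by_cases hs1 : dw s = true
          · have e : stepI dw (false :: false :: a, s :: u, g) = (false :: true :: a, u, g) := by
              simp [stepI, hs1]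
            rw [e]
            refine ⟨fun z => ?_, by simpa using by simp at ha; omega, ?_⟩
            · rw [hreal, List.map_cons, (hdw s).1 hs1, List.cons_append, iota_001, hreal]
            · rcases hc with h | h | ⟨s, t, h, h'⟩
              · exact Or.inl h
              · exact Or.inr (Or.inl (by simpa using h))
              · exact Or.inr (Or.inr ⟨s, t, h, fun w hw => h' w (by omega)⟩)
          · have e : stepI dw (false :: false :: a, s :: u, g) = (false :: false :: a, s :: u, g) := by
              simp [stepI, hs1]
            rw [e]
            refine ⟨fun z => ?_, by simpa using by simp at ha; omega, hc.mono ρ (by omega)⟩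
            rw [hreal, iota_00]
            rw [hdw] at hs1
            simpa using hs1
  · rcases a with _ | ⟨i, _ | ⟨j, a⟩⟩
    · simp at ha
    · simp at ha
    have hreal : ∀ (i j : Bool) (u : List (LW m)) (g : LW m) (z : Stream' Bool),
      real ρ (i :: j :: a, u, g) z rest =
      ([i, j] ++ₛ (a ++ₛ z), u.map (ev ρ) ++ labH (ev ρ g) rest) := fun i j u g z => rfl
    simp only [step, act]
    by_cases hij : [i, j] = [false, false]
    · obtain ⟨rfl, rfl⟩ : i = false ∧ j = false := by simpa using hij
      cases u with
      | nil =>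
        have e : stepP p (false :: false :: a, [], g) = (false :: false :: a, [], p :: g) := by
          simp [stepP]
        rw [e]
        refine ⟨fun z => ?_, by simpa using by simp at ha; omega, ?_⟩
        · rw [hreal, lab_00, hreal, ev_cons ρ p g, labH_mul]; rfl
        · rcases hc with h | h | ⟨s, t, h, h'⟩
          · exact Or.inl h
          · simp at h
          · refine Or.inr (Or.inr ⟨s, t, h, fun w hw => ?_⟩)
            have := h' (w ++ [p]) (by simpa using hw)
            rw [ev_append] at this
            simpa only [ev_cons ρ p g, mul_assoc] using this
      | cons s u =>
        have e : stepP p (false :: false :: a, s :: u, g) = (false :: false :: a, (p :: s) :: u, g) := by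
          simp [stepP]
        rw [e]
        refine ⟨fun z => ?_, by simpa using by simp at ha; omega, ?_⟩
        · rw [hreal, lab_00, hreal, List.map_cons, List.map_cons, ev_cons ρ p s]; rfl
        · exact Cond.mono ρ (n := n + 1) (by simpa [Cond] using hc) (by omega)
    · have e : stepP p (i :: j :: a, u, g) = (i :: j :: a, u, g) := by
        simp only [stepP]; rw [if_neg]; simpa using hij
      rw [e]
      refine ⟨fun z => ?_, by simpa using by simp at ha; omega, hc.mono ρ (by omega)⟩
      rw [hreal, lab_else _ _ _ hij]

theorem sim_real_aux (hdw : ∀ w, dw w = true ↔ ev ρ w = 1) {W : List (SC m)} (hW : ∀ s ∈ W, GoodSC s) {k : ℕ} {st : SSt m} {rest : List L}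
    (ha : W.length + k + 2 ≤ st.1.length) (hc : Cond ρ (W.length + k) st.2.1 st.2.2 rest) :
    (∀ z, (W.map (act ρ)).prod (real ρ st z rest) = real ρ (sim dw W st) z rest) ∧
      k + 2 ≤ (sim dw W st).1.length ∧
      Cond ρ k (sim dw W st).2.1 (sim dw W st).2.2 rest := by
  induction W generalizing k with
  | nil => 
    refine ⟨fun z => rfl, by simpa [sim] using ha, by simpa [sim] using hc⟩
  | cons s W ih =>
    have h1 : (s :: W).length + k = W.length + (k + 1) := by simp; omega
    rw [h1] at ha hc
    obtain ⟨i1, i2, i3⟩ := ih (fun t ht => hW t (by simp [ht])) ha hc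
    obtain ⟨j1, j2, j3⟩ := step_real ρ hdw (hW s (by simp)) (by omega) i3
    refine ⟨fun z => ?_, j2, j3⟩
    rw [List.map_cons, List.prod_cons, Equiv.Perm.mul_apply, i1, j1]; rfl

theorem sim_real (hdw : ∀ w, dw w = true ↔ ev ρ w = 1) {W : List (SC m)} (hW : ∀ s ∈ W, GoodSC s) {st : SSt m} {rest : List L}
    (ha : W.length + 2 ≤ st.1.length) (hc : Cond ρ W.length st.2.1 st.2.2 rest) (z : Stream' Bool) :
    (W.map (act ρ)).prod (real ρ st z rest) = real ρ (sim dw W st) z rest :=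
  (sim_real_aux ρ hdw (k := 0) hW ha hc).1 z

end Sim


section Grp

theorem inc_of_len {u v : List Bool} (h : u.length = v.length) (hne : u ≠ v) : Inc u v :=
  ⟨fun hp => hne (hp.eq_of_length h), fun hp => hne (hp.eq_of_length h.symm).symm⟩

theorem Inc.app_left {r x y : List Bool} (h : Inc x y) : Inc (r ++ x) (r ++ y) :=
  ⟨fun hp => h.1 ((List.prefix_append_right_inj r).1 hp),
   fun hp => h.2 ((List.prefix_append_right_inj r).1 hp)⟩

theorem Inc.of_app_left {r x y : List Bool} (h : Inc (r ++ x) (r ++ y)) : Inc x y :=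
  ⟨fun hp => h.1 ((List.prefix_append_right_inj r).2 hp),
   fun hp => h.2 ((List.prefix_append_right_inj r).2 hp)⟩

theorem exists_r (p q : List Bool) (hp : 2 ≤ p.length) (hq : 2 ≤ q.length) :
    ∃ r : List Bool, r.length = 2 ∧ Inc r p ∧ Inc r q := by
  rcases p with _ | ⟨i, _ | ⟨j, p⟩⟩
  · simp at hp
  · simp at hp
  rcases q with _ | ⟨k, _ | ⟨l, q⟩⟩
  · simp at hq
  · simp at hq
  have key : ∀ i j k l : Bool, ∃ a b : Bool, [a, b] ≠ [i, j] ∧ [a, b] ≠ [k, l] := by decide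
  obtain ⟨a, b, h1, h2⟩ := key i j k l
  refine ⟨[a, b], rfl, ?_, ?_⟩
  · exact (inc_of_len (u := [a, b]) (v := [i, j]) rfl h1).extend_both (List.prefix_refl _) ⟨p, rfl⟩
  · exact (inc_of_len (u := [a, b]) (v := [k, l]) rfl h2).extend_both (List.prefix_refl _) ⟨q, rfl⟩

variable {L : Type} [Group L] {m : ℕ} (ρ : FreeGroup (Fin m) →* L)

theorem conj_sig {q : Equiv.Perm (Om L)} {u v u' v' : List Bool} (h : Inc u v) (h' : Inc u' v')
    (hu : ∀ z x, q (u ++ₛ z, x) = (u' ++ₛ z, x)) (hv : ∀ z x, q (v ++ₛ z, x) = (v' ++ₛ z, x)) :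
    q * sig L u v * q⁻¹ = sig L u' v' := by
  rw [mul_inv_eq_iff_eq_mul]
  ext1 ⟨c, x⟩
  rw [Equiv.Perm.mul_apply, Equiv.Perm.mul_apply]
  by_cases h1 : InC u c
  · obtain ⟨z, rfl⟩ := h1
    rw [sig_left h, hu, hv, sig_left h']
  by_cases h2 : InC v c
  · obtain ⟨z, rfl⟩ := h2
    rw [sig_right h, hu, hv, sig_right h']
  rw [sig_else h1 h2]
  rcases hq : q (c, x) with ⟨c', x'⟩
  refine (sig_else ?_ ?_ _).symm
  · rintro ⟨z, rfl⟩
    rw [← hu] at hq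
    exact h1 ⟨z, congrArg Prod.fst (q.injective hq)⟩
  · rintro ⟨z, rfl⟩
    rw [← hv] at hq
    exact h2 ⟨z, congrArg Prod.fst (q.injective hq)⟩

/-- pairs for the generating swaps -/
def swPairs : List (List Bool × List Bool) :=
  ((enumLists [false, true] 3).product (enumLists [false, true] 3)).filter
    (fun q => decide (Inc q.1 q.2 ∧ (q.1.length = 2 ∨ q.1.length = 3) ∧
      (q.2.length = 2 ∨ q.2.length = 3)))

theorem mem_swPairs (q : List Bool × List Bool) : q ∈ swPairs ↔
    (Inc q.1 q.2 ∧ (q.1.length = 2 ∨ q.1.length = 3) ∧ (q.2.length = 2 ∨ q.2.length = 3)) := by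
  unfold swPairs
  rw [List.mem_filter, List.product, List.mem_flatMap]
  simp only [mem_enumLists, List.mem_map, decide_eq_true_eq]
  constructor
  · exact fun h => h.2
  · intro h
    refine ⟨⟨q.1, ⟨by omega, by simp⟩, q.2, ⟨by omega, by simp⟩, rfl⟩, h⟩

/-- generators of the big group -/
def genList (m : ℕ) : List (SC m) :=
  swPairs.map Sum.inl ++ (Sum.inr (Sum.inl ()) ::
    (List.finRange m).map (fun j => Sum.inr (Sum.inr (j, true))))

theorem genList_good {s : SC m} (hs : s ∈ genList m) : GoodSC s := by
  simp only [genList, List.mem_append, List.mem_map, List.mem_cons] at hs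
  rcases hs with ⟨q, hq, rfl⟩ | rfl | ⟨j, -, rfl⟩
  · exact (mem_swPairs q).1 hq
  · trivial
  · trivial

/-- the big group -/
def HH : Subgroup (Equiv.Perm (Om L)) := Subgroup.closure (act ρ '' {s | s ∈ genList m})

theorem HH_word {h : Equiv.Perm (Om L)} (hh : h ∈ HH ρ) :
    ∃ W : List (SC m), (∀ s ∈ W, GoodSC s) ∧ h = (W.map (act ρ)).prod := by
  induction hh using Subgroup.closure_induction with
  | mem x hx =>
    obtain ⟨s, hs, rfl⟩ := hx
    exact ⟨[s], by simpa using genList_good hs, by simp⟩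
  | one => exact ⟨[], by simp, by simp⟩
  | mul x y _ _ hx hy =>
    obtain ⟨W, h1, rfl⟩ := hx
    obtain ⟨W', h2, rfl⟩ := hy
    refine ⟨W ++ W', ?_, by simp⟩
    intro s hs
    rcases List.mem_append.1 hs with h | h
    · exact h1 s h
    · exact h2 s h
  | inv x _ hx =>
    obtain ⟨W, h1, rfl⟩ := hx
    refine ⟨(W.map invSC).reverse, ?_, ?_⟩
    · intro s hs
      simp only [List.mem_reverse, List.mem_map] at hs
      obtain ⟨t, ht, rfl⟩ := hs
      exact (h1 t ht).inv
    · rw [List.prod_inv_reverse, List.map_map, List.map_reverse, List.map_map]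
      congr 2
      apply List.map_congr_left
      intro t _
      exact (act_invSC ρ t).symm

theorem iota_mem : iota L ∈ HH ρ :=
  Subgroup.subset_closure ⟨Sum.inr (Sum.inl ()), by simp [genList], rfl⟩

theorem lab_mem (hρ : Function.Surjective ρ) (g : L) : lab g ∈ HH ρ := by
  obtain ⟨w, rfl⟩ := hρ g
  induction w using FreeGroup.induction_on with
  | C1 => rw [map_one, map_one]; exact one_mem _
  | of j => exact Subgroup.subset_closure ⟨Sum.inr (Sum.inr (j, true)), by simp [genList], rfl⟩
  | inv_of j h => rw [map_inv, map_inv]; exact inv_mem h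
  | mul x y hx hy => rw [map_mul, map_mul]; exact mul_mem hx hy

theorem sig_mem_gen {u v : List Bool} (h : Inc u v) (hu : u.length = 2 ∨ u.length = 3)
    (hv : v.length = 2 ∨ v.length = 3) : sig L u v ∈ HH ρ :=
  Subgroup.subset_closure ⟨Sum.inl (u, v), by
    simp only [Set.mem_ofPred_eq, genList, List.mem_append, List.mem_map]
    exact Or.inl ⟨(u, v), (mem_swPairs _).2 ⟨h, hu, hv⟩, rfl⟩, rfl⟩

theorem sig_mem_aux (n : ℕ) : ∀ {u v : List Bool}, Inc u v → 2 ≤ u.length → 2 ≤ v.length →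
    u.length + v.length ≤ n → sig L u v ∈ HH ρ := by
  induction n with
  | zero => intro u v _ h1 h2 h3; omega
  | succ n ih =>
    have main : ∀ {u v : List Bool}, Inc u v → 4 ≤ u.length → 2 ≤ v.length →
        u.length + v.length ≤ n + 1 → sig L u v ∈ HH ρ := by
      intro u v h h1 h2 h3
      set p := u.take 3 with hp
      set y := u.drop 3 with hy
      have hpl : p.length = 3 := by simp [hp]; omega
      have hu : u = p ++ y := (List.take_append_drop 3 u).symm
      have hyl : y.length + 3 = u.length := by simp [hy]; omega
      obtain ⟨r, hr, hrp, hrv⟩ := exists_r p v (by omega) h2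
      have hq := sig_mem_gen ρ hrp.symm (Or.inr hpl) (Or.inl hr)
      have hmove : ∀ (b : List Bool) (z : Stream' Bool) (x : List L),
          sig L p r ((p ++ b) ++ₛ z, x) = ((r ++ b) ++ₛ z, x) := by
        intro b z x
        rw [Stream'.append_append_stream, Stream'.append_append_stream, sig_left hrp.symm]
      have fin : ∀ v' : List Bool, Inc (r ++ y) v' → 2 ≤ v'.length → v'.length ≤ v.length →
          (∀ z x, sig L p r (v ++ₛ z, x) = (v' ++ₛ z, x)) → sig L u v ∈ HH ρ := by
        intro v' i1 i2 i3 i4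
        have e := conj_sig (L := L) h i1 (by rw [hu]; exact hmove y) i4
        have hm : sig L (r ++ y) v' ∈ HH ρ := ih i1 (by simp; omega) i2 (by simp; omega)
        rw [← e] at hm
        have h5 := mul_mem (mul_mem (inv_mem hq) hm) hq
        simpa [mul_assoc] using h5
      by_cases hpv : p <+: v
      · obtain ⟨b, rfl⟩ := hpv
        refine fin (r ++ b) ?_ (by simp; omega) (by simp; omega) (hmove b)
        rw [hu] at h
        exact h.of_app_left.app_left
      · have hvp : ¬ v <+: p := fun hvp => h.2 (hvp.trans ⟨y, hu.symm⟩)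
        refine fin v ?_ h2 le_rfl (fun z x => sig_fix ⟨hpv, hvp⟩ hrv z x)
        exact hrv.extend_both (List.prefix_append _ _) (List.prefix_refl _)
    intro u v h h1 h2 h3
    by_cases hu : 4 ≤ u.length
    · exact main h hu h2 h3
    by_cases hv : 4 ≤ v.length
    · rw [sig_comm]; exact main h.symm hv h1 (by omega)
    exact sig_mem_gen ρ h (by omega) (by omega)

theorem sig_mem {u v : List Bool} (h : Inc u v) (h1 : 2 ≤ u.length) (h2 : 2 ≤ v.length) :
    sig L u v ∈ HH ρ := sig_mem_aux ρ _ h h1 h2 le_rfl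

theorem exists_words (hρ : Function.Surjective ρ) (u : List L) : ∃ u0 : List (LW m), u = u0.map (ev ρ) := by
  induction u with
  | nil => exact ⟨[], rfl⟩
  | cons s u ih =>
    obtain ⟨u0, rfl⟩ := ih
    obtain ⟨w, rfl⟩ := hρ s
    refine ⟨w.toWord :: u0, ?_⟩
    simp [ev, FreeGroup.mk_toWord]

/-- exceptional set -/
def badSet (N : ℕ) : Set L := {s | ∃ w : LW m, w.length ≤ N ∧ ev ρ w * s = 1}

theorem badSet_finite (N : ℕ) : (badSet ρ N).Finite := by
  refine ((List.finite_toSet (enumLists (Finset.univ.toList : List (Fin m × Bool)) N)).image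
    (fun w => (ev ρ w)⁻¹)).subset ?_
  rintro s ⟨w, hw, h⟩
  refine ⟨w, ?_, ?_⟩
  · simp only [Set.mem_ofPred_eq]
    rw [mem_enumLists]
    exact ⟨hw, by simp⟩
  · exact (eq_inv_of_mul_eq_one_right h).symm

/-- local normal form of elements of the big group -/
theorem gen_form (hρ : Function.Surjective ρ) {h : Equiv.Perm (Om L)} (hh : h ∈ HH ρ)
    (c : Stream' Bool) (u : List L) :
    ∃ (a a' : List Bool) (z0 : Stream' Bool) (u' : List L) (g : L) (E : Set L), E.Finite ∧
      c = a ++ₛ z0 ∧ (∀ z, h (a ++ₛ z, u) = (a' ++ₛ z, u')) ∧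
      ∀ z s t, s ∉ E → h (a ++ₛ z, u ++ s :: t) = (a' ++ₛ z, u' ++ (g * s) :: t) := by
  classical
  obtain ⟨W, hW, rfl⟩ := HH_word ρ hh
  obtain ⟨u0, rfl⟩ := exists_words ρ hρ u
  obtain ⟨a, z0, hal, rfl⟩ := stream_split (W.length + 2) c
  have hdw : ∀ w : LW m, (fun w => decide (ev ρ w = 1)) w = true ↔ ev ρ w = 1 := by simp
  set st := sim (fun w => decide (ev ρ w = 1)) W (a, u0, []) with hst
  refine ⟨a, st.1, z0, st.2.1.map (ev ρ), ev ρ st.2.2, badSet ρ W.length, badSet_finite ρ _, rfl, ?_, ?_⟩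
  · intro z
    have := sim_real ρ hdw hW (st := (a, u0, [])) (rest := []) hal.ge (Or.inl rfl) z
    simpa [real, labH, ev_nil] using this
  · intro z s t hs
    have := sim_real ρ hdw hW (st := (a, u0, [])) (rest := s :: t) hal.ge
      (Or.inr (Or.inr ⟨s, t, rfl, ?_⟩)) z
    · simpa [real, labH, ev_nil] using this
    · intro w hw he
      exact hs ⟨w, hw, by simpa [ev_nil] using he⟩

end Grp


section Emb

variable {L : Type} [Group L] {m : ℕ} (ρ : FreeGroup (Fin m) →* L)

/-- generators of the big group, indexed -/
noncomputable def genH (k : Fin (genList m).length) : HH ρ :=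
  ⟨act ρ ((genList m).get k), Subgroup.subset_closure ⟨_, List.get_mem _ _, rfl⟩⟩

theorem genH_closure : Subgroup.closure (Set.range (genH ρ)) = ⊤ := by
  have h := Subgroup.closure_closure_coe_preimage (k := act ρ '' {s | s ∈ genList m})
  have h2 : Set.range (genH ρ) = ((↑) : HH ρ → Equiv.Perm (Om L)) ⁻¹' (act ρ '' {s | s ∈ genList m}) := by
    ext ⟨x, hx⟩
    constructor
    · rintro ⟨k, hk⟩
      exact ⟨(genList m).get k, List.get_mem _ _, congrArg Subtype.val hk⟩
    · rintro ⟨s, hs, hs2⟩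
      obtain ⟨k, hk⟩ := List.get_of_mem hs
      exact ⟨k, Subtype.ext (by simp only [genH, hk]; exact hs2)⟩
  rw [h2]; exact h

/-- presentation of the big group -/
noncomputable def rhoH : FreeGroup (Fin (genList m).length) →* HH ρ := FreeGroup.lift (genH ρ)

theorem rhoH_surj : Function.Surjective (rhoH ρ) := by
  rw [← MonoidHom.range_eq_top, rhoH, FreeGroup.range_lift_eq_closure, genH_closure]

/-- the embedding -/
noncomputable def phiH (hρ : Function.Surjective ρ) : L →* HH ρ :=
  lab.codRestrict (HH ρ) (lab_mem ρ hρ)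

theorem phiH_coe (hρ : Function.Surjective ρ) (g : L) : (phiH ρ hρ g : Equiv.Perm (Om L)) = lab g := rfl

theorem labH_prod (g : L) (x : List L) : (labH g x).prod * x.prod⁻¹ = g ∨
    (labH g x).prod * x.prod⁻¹ = 1 := by
  cases x with
  | nil => right; simp [labH]
  | cons s t => left; simp [labH]

theorem act_jump (s : SC m) (hs : s ∈ genList m) (p : Om L) :
    (act ρ s p).2.prod * p.2.prod⁻¹ ∈ insert (1 : L) (Set.range fun j : Fin m => ev ρ [(j, true)]) := by
  obtain ⟨c, x⟩ := p
  simp only [genList, List.mem_append, List.mem_map, List.mem_cons] at hs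
  rcases hs with ⟨q, hq, rfl⟩ | rfl | ⟨j, -, rfl⟩
  · left
    simp only [act]
    rw [sig_apply ((mem_swPairs q).1 hq).1]; simp
  · left
    simp only [act]
    obtain ⟨i, j, z, rfl⟩ := stream_split2 c
    cases i with
    | true => rw [iota_1]; simp
    | false =>
      cases j with
      | true => rw [iota_01]; simp
      | false =>
        by_cases h : x.head? = some 1
        · cases x with
          | nil => simp at h
          | cons s t =>
            have : s = 1 := by simpa using h
            subst this
            rw [iota_001]; simp
        · rw [iota_00 _ _ h]; simp
  · simp only [act]
    obtain ⟨i, k, z, rfl⟩ := stream_split2 c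
    by_cases hik : [i, k] = [false, false]
    · rw [hik, lab_00]
      rcases labH_prod (ev ρ [(j, true)]) x with h | h
      · right; exact ⟨j, h.symm⟩
      · left; exact h
    · left; rw [lab_else _ _ _ hik]; simp

theorem phiH_qi (hρ : Function.Surjective ρ) {Z : Finset L} (hZ : Generates Z) :
    ∃ Y : Finset (HH ρ), Generates Y ∧ IsQIEmbedding Z Y (phiH ρ hρ) := by
  classical
  refine ⟨Finset.univ.image (genH ρ), ?_, ?_⟩
  · rw [Generates, ← genH_closure]; congr 1; simp
  have hY : Generates (Finset.univ.image (genH ρ)) := by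
    rw [Generates, ← genH_closure]; congr 1; simp
  refine qi_of_potential (Ω := Om L) hZ hY (phiH ρ hρ) (fun p => p.2.prod)
    (insert (1 : L) (Set.range fun j : Fin m => ev ρ [(j, true)])) ((Set.finite_range _).insert _) ?_
    ([false, false] ++ₛ Stream'.const false, [1]) ?_
  · intro y hy p
    simp only [Finset.mem_image, Finset.mem_univ, true_and] at hy
    obtain ⟨k, rfl⟩ := hy
    exact act_jump ρ _ (List.get_mem _ _) p
  · intro g
    have : phiH ρ hρ g • (([false, false] ++ₛ Stream'.const false, [1]) : Om L) =
      ([false, false] ++ₛ Stream'.const false, labH g [1]) := lab_00 g _ _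
    rw [this]; simp [labH]

theorem exists_generic [Infinite L] {E : Set L} (hE : E.Finite) : ∃ s, s ∉ E :=
  hE.infinite_compl.nonempty

theorem phiH_frattini [Infinite L] (hρ : Function.Surjective ρ) : IsFrattini (phiH ρ hρ) := by
  apply frattini_of
  · intro a b hab
    have h1 : lab a = lab b := congrArg Subtype.val hab
    have h2 := congrArg (fun f => f ([false, false] ++ₛ Stream'.const false, [1])) h1
    simp only [lab_00] at h2
    simpa [labH] using congrArg Prod.snd h2
  · rintro a b ⟨h, hh⟩ heq
    have heq' : h * lab a = lab b * h := congrArg Subtype.val heq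
    obtain ⟨p, p', z0, u', g, E, hE, hc, -, hgen⟩ := gen_form ρ hρ hh
      ([false, false] ++ₛ Stream'.const false) []
    have hE2 : (E ∪ (fun s => a * s) ⁻¹' E).Finite :=
      hE.union (hE.preimage (mul_right_injective a).injOn)
    obtain ⟨s, hs⟩ := exists_generic hE2
    have hs1 : s ∉ E := fun h' => hs (Or.inl h')
    have hs2 : a * s ∉ E := fun h' => hs (Or.inr h')
    have e1 := congrArg (fun f => f ([false, false] ++ₛ Stream'.const false, [s])) heq'
    simp only [Equiv.Perm.mul_apply, lab_00] at e1
    have f1 := hgen z0 (a * s) [] hs2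
    have f2 := hgen z0 s [] hs1
    rw [← hc] at f1 f2
    simp only [List.nil_append] at f1 f2
    simp only [labH] at e1
    rw [f1, f2] at e1
    obtain ⟨i, j, z, hz⟩ := stream_split2 (p' ++ₛ z0)
    rw [hz] at e1
    by_cases hij : [i, j] = [false, false]
    · rw [hij, lab_00] at e1
      have e2 := congrArg Prod.snd e1
      cases u' with
      | nil =>
        simp only [labH, List.nil_append, List.cons.injEq, and_true] at e2
        rw [isConj_iff]
        refine ⟨g, ?_⟩
        have : g * a * s = b * g * s := by simpa [mul_assoc] using e2
        rw [mul_right_cancel this]; group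
      | cons t u' =>
        simp only [labH, List.cons_append, List.cons.injEq, List.append_cancel_left_eq, and_true] at e2
        obtain ⟨h1, h2⟩ := e2
        have ha : a = 1 := by simpa using h2
        have hb : b = 1 := by simpa using h1
        rw [ha, hb]
    · rw [lab_else _ _ _ hij] at e1
      have e2 := congrArg Prod.snd e1
      simp only [List.append_cancel_left_eq, List.cons.injEq, and_true] at e2
      have ha : a = 1 := by simpa using e2
      subst ha
      have : lab b = 1 := by
        rw [map_one, mul_one] at heq'
        exact (mul_eq_right.1 heq'.symm)
      have h2 := congrArg (fun f => f ([false, false] ++ₛ Stream'.const false, [1])) this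
      simp only [lab_00] at h2
      have hb : b = 1 := by simpa [labH] using congrArg Prod.snd h2
      rw [hb]

end Emb


section Simple

variable {L : Type} [Group L] {m : ℕ} (ρ : FreeGroup (Fin m) →* L)

theorem moved_box [Infinite L] (hρ : Function.Surjective ρ) {f : Equiv.Perm (Om L)} (hf : f ∈ HH ρ)
    (hf1 : f ≠ 1) : ∃ (a : List Bool) (u : List L), 2 ≤ a.length ∧
      ∀ z t z' t', f (a ++ₛ z, u ++ t) ≠ (a ++ₛ z', u ++ t') := by
  obtain ⟨⟨c, u⟩, hp⟩ : ∃ p, f p ≠ p := by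
    by_contra hcon
    push Not at hcon
    exact hf1 (Equiv.ext hcon)
  obtain ⟨a, a', z0, u', g, E, hE, hc, h1, h2⟩ := gen_form ρ hρ hf c u
  have hE2 : (E ∪ ({s | s ∈ u'} ∪ (fun s => g * s) ⁻¹' {s | s ∈ u})).Finite :=
    hE.union ((List.finite_toSet u').union
      ((List.finite_toSet u).preimage (mul_right_injective g).injOn))
  obtain ⟨s, hs⟩ := exists_generic hE2
  have hs1 : s ∉ E := fun h' => hs (Or.inl h')
  have hs2 : s ∉ u' := fun h' => hs (Or.inr (Or.inl h'))
  have hs3 : g * s ∉ u := fun h' => hs (Or.inr (Or.inr h'))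
  by_cases huu : u = u'
  · subst huu
    have hne : a' ++ₛ z0 ≠ a ++ₛ z0 := by
      intro e
      apply hp
      rw [hc, h1, e]
    obtain ⟨n, hn⟩ : ∃ n, (a' ++ₛ z0).take n ≠ (a ++ₛ z0).take n := by
      by_contra hcon
      push Not at hcon
      exact hne (Stream'.take_theorem _ _ hcon)
    have ht : ∀ (b : List Bool) (z : Stream' Bool),
        (b ++ₛ (z0.take (n + 2) ++ₛ z)).take n = (b ++ₛ z0).take n := by
      intro b z
      conv_rhs => rw [← Stream'.append_take_drop (n + 2) z0]
      rw [← Stream'.append_append_stream, ← Stream'.append_append_stream,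
        Stream'.take_append_of_le_length _ _ _ (by simp; omega),
        Stream'.take_append_of_le_length _ _ _ (by simp; omega)]
    refine ⟨a ++ z0.take (n + 2), u ++ [s], by simp; omega, ?_⟩
    intro z t z' t' e
    rw [Stream'.append_append_stream, Stream'.append_append_stream, List.append_assoc,
      List.singleton_append, h2 _ _ _ hs1] at e
    have e1 := congrArg (Stream'.take n) (congrArg Prod.fst e)
    simp only [ht] at e1
    exact hn e1
  · obtain ⟨b, z1, hb, hz1⟩ := stream_split 2 z0
    refine ⟨a ++ b, u ++ [s], by simp; omega, ?_⟩
    intro z t z' t' e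
    rw [Stream'.append_append_stream, List.append_assoc, List.singleton_append, h2 _ _ _ hs1] at e
    have e1 : u' ++ (g * s) :: t = u ++ s :: t' := by
      have := congrArg Prod.snd e
      simpa using this
    rcases List.append_eq_append_iff.1 e1 with ⟨v, h3, h4⟩ | ⟨v, h3, h4⟩
    · cases v with
      | nil => exact huu (by simpa using h3)
      | cons w v =>
        have : g * s = w := by simpa using congrArg List.head? h4
        apply hs3
        rw [h3, this]; simp
    · cases v with
      | nil => exact huu (by simpa using h3.symm)
      | cons w v =>
        have : s = w := by simpa using congrArg List.head? h4
        apply hs2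
        rw [h3, this]; simp

theorem compress1 (r : List Bool) (hr : r.length = 2) (a : List Bool) (ha : 2 ≤ a.length) :
    ∃ h ∈ HH ρ, ∀ c t, ¬ InC r c → ∃ z, h (c, t) = (a ++ₛ z, t) := by
  have main : ∀ (i j : Bool) (a' : List Bool), ∃ h ∈ HH ρ, ∀ c t, ¬ InC [i, j] c →
      ∃ z, h (c, t) = (([i, j] ++ a') ++ₛ z, t) := by
    intro i j a'
    have inc2 : ∀ {x y : List Bool} {k l : Bool}, [k, l] ≠ [i, j] → Inc [k, l] ([i, j] ++ x) := by
      intro x y k l h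
      exact (inc_of_len (u := [k, l]) (v := [i, j]) rfl h).extend_both (List.prefix_refl _) ⟨x, rfl⟩
    have incA : ∀ {k l k' l' : Bool}, [k, l] ≠ [k', l'] →
        Inc ([i, j] ++ (a' ++ [k, l])) ([i, j] ++ (a' ++ [k', l'])) := fun h =>
      (inc_of_len (by rfl) h).app_left.app_left
    have n1 : [!i, j] ≠ [i, j] := by cases i <;> simp
    have n2 : [i, !j] ≠ [i, j] := by cases j <;> simp
    have n3 : [!i, !j] ≠ [i, j] := by cases i <;> simp
    have i12 : Inc [!i, j] [i, !j] := inc_of_len rfl (by cases i <;> simp)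
    have i13 : Inc [!i, j] [!i, !j] := inc_of_len rfl (by cases j <;> simp)
    have i23 : Inc [i, !j] [!i, !j] := inc_of_len rfl (by cases i <;> simp)
    have A1 := inc2 (x := a' ++ [false, false]) (y := []) n1
    have A2 := inc2 (x := a' ++ [false, true]) (y := []) n2
    have A3 := inc2 (x := a' ++ [true, false]) (y := []) n3
    have A12 := inc2 (x := a' ++ [false, true]) (y := []) n1
    have A13 := inc2 (x := a' ++ [true, false]) (y := []) n1
    have A21 := inc2 (x := a' ++ [false, false]) (y := []) n2
    have A23 := inc2 (x := a' ++ [true, false]) (y := []) n2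
    have A31 := inc2 (x := a' ++ [false, false]) (y := []) n3
    have A32 := inc2 (x := a' ++ [false, true]) (y := []) n3
    refine ⟨sig L [!i, j] ([i, j] ++ (a' ++ [false, false])) *
      (sig L [i, !j] ([i, j] ++ (a' ++ [false, true])) *
      sig L [!i, !j] ([i, j] ++ (a' ++ [true, false]))),
      mul_mem (sig_mem ρ A1 (by simp) (by simp)) (mul_mem (sig_mem ρ A2 (by simp) (by simp))
        (sig_mem ρ A3 (by simp) (by simp))), ?_⟩
    intro c t hc
    obtain ⟨k, l, z, rfl⟩ := stream_split2 c
    simp only [Equiv.Perm.mul_apply]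
    by_cases h1 : [k, l] = [!i, j]
    · rw [h1]
      refine ⟨[false, false] ++ₛ z, ?_⟩
      rw [sig_fix i13.symm A13.symm, sig_fix i12.symm A12.symm, sig_left A1]
      rw [← List.append_assoc, Stream'.append_append_stream]
    by_cases h2 : [k, l] = [i, !j]
    · rw [h2]
      refine ⟨[false, true] ++ₛ z, ?_⟩
      rw [sig_fix i23.symm A23.symm, sig_left A2, sig_fix A12 (incA (by simp))]
      rw [← List.append_assoc, Stream'.append_append_stream]
    by_cases h3 : [k, l] = [!i, !j]
    · rw [h3]
      refine ⟨[true, false] ++ₛ z, ?_⟩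
      rw [sig_left A3, sig_fix A23 (incA (by simp)), sig_fix A13 (incA (by simp))]
      rw [← List.append_assoc, Stream'.append_append_stream]
    exfalso
    apply hc
    refine ⟨z, ?_⟩
    congr 1
    revert h1 h2 h3
    cases i <;> cases j <;> cases k <;> cases l <;> simp
  rcases a with _ | ⟨i, _ | ⟨j, a'⟩⟩
  · simp at ha
  · simp at ha
  obtain ⟨h, hh, H⟩ := main i j a'
  by_cases hri : r = [i, j]
  · subst hri; exact ⟨h, hh, H⟩
  · have hinc : Inc r [i, j] := inc_of_len hr hri
    refine ⟨h * sig L r [i, j], mul_mem hh (sig_mem ρ hinc hr.ge (by simp)), ?_⟩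
    intro c t hc
    rw [Equiv.Perm.mul_apply, sig_apply hinc]
    apply H
    rintro ⟨z, hz⟩
    apply hc
    refine ⟨z, ?_⟩
    rw [← swS_right hinc, ← hz, swS_inv hinc]

theorem exists_q (a : List Bool) (ha : 2 ≤ a.length) :
    ∃ q ∈ HH ρ, ∀ z t, q ([false, false] ++ₛ z, t) = (a ++ₛ z, t) := by
  rcases a with _ | ⟨i, _ | ⟨j, a'⟩⟩
  · simp at ha
  · simp at ha
  by_cases h : [i, j] = [false, false]
  · have i1 : Inc [true, true] (i :: j :: a') :=
      (inc_of_len (u := [true, true]) (v := [i, j]) rfl (by rw [h]; simp)).extend_both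
        (List.prefix_refl _) ⟨a', rfl⟩
    have i2 : Inc [false, false] [true, true] := by decide
    refine ⟨sig L [true, true] (i :: j :: a') * sig L [false, false] [true, true],
      mul_mem (sig_mem ρ i1 (by simp) ha) (sig_mem ρ i2 (by simp) (by simp)), ?_⟩
    intro z t
    rw [Equiv.Perm.mul_apply, sig_left i2, sig_left i1]
  · have i1 : Inc [false, false] (i :: j :: a') :=
      (inc_of_len (u := [false, false]) (v := [i, j]) rfl (Ne.symm h)).extend_both
        (List.prefix_refl _) ⟨a', rfl⟩
    exact ⟨sig L [false, false] (i :: j :: a'), sig_mem ρ i1 (by simp) ha, fun z t => sig_left i1 z t⟩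

theorem compress2 (hρ : Function.Surjective ρ) (a : List Bool) (ha : 2 ≤ a.length) (u : List L) :
    ∃ h ∈ HH ρ, ∀ z t, h (a ++ₛ z, t) = (a ++ₛ z, u ++ t) := by
  obtain ⟨q, hq, hqa⟩ := exists_q ρ a ha
  have i2 : Inc [false, false] [false, true] := by decide
  have hqi : ∀ z t, q⁻¹ (a ++ₛ z, t) = ([false, false] ++ₛ z, t) := by
    intro z t
    rw [Equiv.Perm.inv_eq_iff_eq, hqa]
  induction u with
  | nil => exact ⟨1, one_mem _, fun z t => rfl⟩
  | cons γ u ih =>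
    obtain ⟨h, hh, H⟩ := ih
    refine ⟨q * (lab γ * (iota L * (sig L [false, false] [false, true] * (q⁻¹ * h)))),
      mul_mem hq (mul_mem (lab_mem ρ hρ γ) (mul_mem (iota_mem ρ)
        (mul_mem (sig_mem ρ i2 (by simp) (by simp)) (mul_mem (inv_mem hq) hh)))), ?_⟩
    intro z t
    simp only [Equiv.Perm.mul_apply]
    rw [H, hqi, sig_left i2, iota_01, lab_00, hqa]
    simp [labH]

variable {N : Subgroup (Equiv.Perm (Om L))}


theorem comm_mem (hN : ∀ h ∈ HH ρ, ∀ x ∈ N, h * x * h⁻¹ ∈ N) [Infinite L] (hρ : Function.Surjective ρ) {f : Equiv.Perm (Om L)} (hf : f ∈ HH ρ)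
    (hfN : f ∈ N) (hf1 : f ≠ 1) {x y : Equiv.Perm (Om L)} (hx : x ∈ HH ρ) (hy : y ∈ HH ρ)
    {r : List Bool} (hr : r.length = 2)
    (hxr : ∀ z t, x (r ++ₛ z, t) = (r ++ₛ z, t)) (hyr : ∀ z t, y (r ++ₛ z, t) = (r ++ₛ z, t)) :
    x * y * x⁻¹ * y⁻¹ ∈ N := by
  obtain ⟨a, u, ha, hbox⟩ := moved_box ρ hρ hf hf1
  obtain ⟨h1, hh1, H1⟩ := compress1 ρ r hr a ha
  obtain ⟨h2, hh2, H2⟩ := compress2 ρ hρ a ha u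
  set h := h2 * h1 with hdef
  have hh : h ∈ HH ρ := mul_mem hh2 hh1
  have H : ∀ c t, ¬ InC r c → ∃ z t', h (c, t) = (a ++ₛ z, u ++ t') := by
    intro c t hc
    obtain ⟨z, hz⟩ := H1 c t hc
    exact ⟨z, t, by rw [hdef, Equiv.Perm.mul_apply, hz, H2]⟩
  have supp : ∀ w : Equiv.Perm (Om L), (∀ z t, w (r ++ₛ z, t) = (r ++ₛ z, t)) →
      ∀ p, (h * w * h⁻¹) p ≠ p → ∃ z t', p = (a ++ₛ z, u ++ t') := by
    intro w hw p hp
    rcases hq : h⁻¹ p with ⟨c, t⟩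
    have hpq : p = h (c, t) := by rw [← hq]; simp
    have hc : ¬ InC r c := by
      rintro ⟨z, rfl⟩
      apply hp
      rw [Equiv.Perm.mul_apply, Equiv.Perm.mul_apply, hq, hw, hpq]
    rw [hpq]
    exact H c t hc
  set x' := h * x * h⁻¹ with hx'
  set y' := h * y * h⁻¹ with hy'
  have hx'H : x' ∈ HH ρ := mul_mem (mul_mem hh hx) (inv_mem hh)
  have hy'H : y' ∈ HH ρ := mul_mem (mul_mem hh hy) (inv_mem hh)
  set x2 := f * x'⁻¹ * f⁻¹ with hx2
  have hdis : Equiv.Perm.Disjoint x2 y' := by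
    intro p
    by_contra hcon
    push Not at hcon
    obtain ⟨c1, c2⟩ := hcon
    obtain ⟨z, t, rfl⟩ := supp y hyr p c2
    have c3 : x' (f⁻¹ (a ++ₛ z, u ++ t)) ≠ f⁻¹ (a ++ₛ z, u ++ t) := by
      intro e
      apply c1
      rw [hx2, Equiv.Perm.mul_apply, Equiv.Perm.mul_apply]
      have : x'⁻¹ (f⁻¹ (a ++ₛ z, u ++ t)) = f⁻¹ (a ++ₛ z, u ++ t) := by
        rw [Equiv.Perm.inv_eq_iff_eq, e]
      rw [this]; simp
    obtain ⟨z', t', e⟩ := supp x hxr _ c3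
    apply hbox z' t' z t
    rw [← e]; simp
  have hcomm : x2 * y' = y' * x2 := hdis.commute
  have k1 : x' * x2 ∈ N := by
    have : x' * x2 = (x' * f * x'⁻¹) * f⁻¹ := by rw [hx2]; group
    rw [this]
    exact mul_mem (hN _ hx'H _ hfN) (inv_mem hfN)
  have k2 : x' * x2 * (y' * (x' * x2)⁻¹ * y'⁻¹) ∈ N :=
    mul_mem k1 (hN _ hy'H _ (inv_mem k1))
  have k3 : x' * x2 * (y' * (x' * x2)⁻¹ * y'⁻¹) = x' * y' * x'⁻¹ * y'⁻¹ := by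
    have : x' * x2 * (y' * (x' * x2)⁻¹ * y'⁻¹) = x' * (x2 * y') * x2⁻¹ * x'⁻¹ * y'⁻¹ := by group
    rw [this, hcomm]; group
  rw [k3] at k2
  have k4 := hN _ (inv_mem hh) _ k2
  have k5 : h⁻¹ * (x' * y' * x'⁻¹ * y'⁻¹) * h⁻¹⁻¹ = x * y * x⁻¹ * y⁻¹ := by
    rw [hx', hy']; group
  rwa [k5] at k4

theorem sig_mem_N (hN : ∀ h ∈ HH ρ, ∀ x ∈ N, h * x * h⁻¹ ∈ N) [Infinite L] (hρ : Function.Surjective ρ) {f : Equiv.Perm (Om L)} (hf : f ∈ HH ρ)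
    (hfN : f ∈ N) (hf1 : f ≠ 1) {u v : List Bool} (h : Inc u v) (hu : 2 ≤ u.length)
    (hv : 2 ≤ v.length) : sig L u v ∈ N := by
  obtain ⟨r, hr, hru, hrv⟩ := exists_r u v hu hv
  have ext : ∀ {p q : List Bool} (b c : List Bool), Inc p q → Inc (p ++ b) (q ++ c) := fun b c hpq =>
    hpq.extend_both (List.prefix_append _ _) (List.prefix_append _ _)
  have extr : ∀ {p : List Bool} (b : List Bool), Inc r p → Inc (p ++ b) r := fun b hpq =>
    hpq.symm.extend_both (List.prefix_append _ _) (List.prefix_refl _)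
  have i00 : Inc (u ++ [false]) (v ++ [false]) := ext _ _ h
  have i11 : Inc (u ++ [true]) (v ++ [true]) := ext _ _ h
  have iu : Inc (u ++ [false]) (u ++ [true]) := (show Inc [false] [true] by decide).app_left
  have iv : Inc (v ++ [false]) (v ++ [true]) := (show Inc [false] [true] by decide).app_left
  have key := comm_mem ρ hN hρ hf hfN hf1 (x := sig L (u ++ [false]) (v ++ [false]))
    (y := sig L (u ++ [false]) (u ++ [true]) * sig L (v ++ [false]) (v ++ [true]))
    (sig_mem ρ i00 (by simp; omega) (by simp; omega))
    (mul_mem (sig_mem ρ iu (by simp; omega) (by simp; omega))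
      (sig_mem ρ iv (by simp; omega) (by simp; omega))) hr
    (fun z t => sig_fix (extr _ hru) (extr _ hrv) z t)
    (fun z t => by
      rw [Equiv.Perm.mul_apply, sig_fix (extr _ hrv) (extr _ hrv), sig_fix (extr _ hru) (extr _ hru)])
  rw [sig_inv] at key
  have e1 := conj_sig (L := L) (q := sig L (u ++ [false]) (u ++ [true]) * sig L (v ++ [false]) (v ++ [true]))
    i00 i11
    (fun z t => by
      rw [Equiv.Perm.mul_apply, sig_fix (ext _ _ h.symm) (ext _ _ h.symm), sig_left iu])
    (fun z t => by
      rw [Equiv.Perm.mul_apply, sig_left iv, sig_fix (ext _ _ h) (ext _ _ h)])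
  rw [mul_assoc, mul_assoc, ← mul_assoc _ _ (_⁻¹), e1] at key
  convert key using 1
  ext1 ⟨c, t⟩
  rw [Equiv.Perm.mul_apply]
  have sp : ∀ (p : List Bool) (b : Bool) (z : Stream' Bool), p ++ₛ ([b] ++ₛ z) = (p ++ [b]) ++ₛ z := by
    intro p b z; rw [Stream'.append_append_stream]
  have spl : ∀ z : Stream' Bool, ∃ (b : Bool) (z' : Stream' Bool), z = [b] ++ₛ z' := fun z =>
    ⟨z.head, z.tail, (Stream'.eta z).symm⟩
  by_cases h1 : InC u c
  · obtain ⟨z, rfl⟩ := h1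
    rw [sig_left h]
    obtain ⟨b, z, rfl⟩ := spl z
    rw [sp, sp]
    cases b
    · rw [sig_fix iu.symm (ext _ _ h.symm), sig_left i00]
    · rw [sig_left i11, sig_fix (ext _ _ h) iv]
  by_cases h2 : InC v c
  · obtain ⟨z, rfl⟩ := h2
    rw [sig_right h]
    obtain ⟨b, z, rfl⟩ := spl z
    rw [sp, sp]
    cases b
    · rw [sig_fix (ext _ _ h) iv.symm, sig_right i00]
    · rw [sig_right i11, sig_fix iu (ext _ _ h.symm)]
  have g : ∀ (p : List Bool) (b : Bool), ¬ InC p c → ¬ InC (p ++ [b]) c := by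
    rintro p b hp ⟨z, rfl⟩
    exact hp ⟨_, (sp p b z).symm⟩
  rw [sig_else h1 h2, sig_else (g _ _ h1) (g _ _ h2), sig_else (g _ _ h1) (g _ _ h2)]

theorem local_mem_N (hN : ∀ h ∈ HH ρ, ∀ x ∈ N, h * x * h⁻¹ ∈ N) [Infinite L] (hρ : Function.Surjective ρ) {f : Equiv.Perm (Om L)} (hf : f ∈ HH ρ)
    (hfN : f ∈ N) (hf1 : f ≠ 1) {y : Equiv.Perm (Om L)} (hy : y ∈ HH ρ)
    (hy1 : ∀ j z t, y ([true, j] ++ₛ z, t) = ([true, j] ++ₛ z, t))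
    (hy0 : ∀ i t, ∃ i' t', ∀ z, y ([false, i] ++ₛ z, t) = ([false, i'] ++ₛ z, t')) : y ∈ N := by
  set s1 := sig L [false, true] [true, false, true] with hs1
  set s2 := sig L [false, false] [true, false, false] with hs2
  set s3 := sig L [true, false, true] [false, true, false] with hs3
  set s4 := sig L [true, false, false] [false, false, false] with hs4
  set q := s4 * (s3 * (s2 * s1)) with hq
  set k := sig L [false, false, false] [false, false, true] * sig L [false, true, false] [false, true, true] with hk
  have hqH : q ∈ HH ρ := mul_mem (sig_mem ρ (by decide) (by simp) (by simp))
    (mul_mem (sig_mem ρ (by decide) (by simp) (by simp))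
    (mul_mem (sig_mem ρ (by decide) (by simp) (by simp)) (sig_mem ρ (by decide) (by simp) (by simp))))
  have hkH : k ∈ HH ρ := mul_mem (sig_mem ρ (by decide) (by simp) (by simp))
    (sig_mem ρ (by decide) (by simp) (by simp))
  have q0 : ∀ i z t, q ([false, i] ++ₛ z, t) = ([false, i, false] ++ₛ z, t) := by
    intro i z t
    simp only [hq, Equiv.Perm.mul_apply]
    cases i
    · rw [hs1, sig_fix (by decide) (by decide), hs2, sig_left (by decide), hs3,
        sig_fix (by decide) (by decide), hs4, sig_left (by decide)]
    · rw [hs1, sig_left (by decide), hs2, sig_fix (by decide) (by decide), hs3,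
        sig_left (by decide), hs4, sig_fix (by decide) (by decide)]
  have q11 : ∀ z t, q ([true, true] ++ₛ z, t) = ([true, true] ++ₛ z, t) := by
    intro z t
    simp only [hq, Equiv.Perm.mul_apply]
    rw [hs1, sig_fix (by decide) (by decide), hs2, sig_fix (by decide) (by decide), hs3,
        sig_fix (by decide) (by decide), hs4, sig_fix (by decide) (by decide)]
  have qi0 : ∀ i z t, q⁻¹ ([false, i, false] ++ₛ z, t) = ([false, i] ++ₛ z, t) := by
    intro i z t; rw [Equiv.Perm.inv_eq_iff_eq, q0]
  have k0 : ∀ i z t, k ([false, i, false] ++ₛ z, t) = ([false, i, true] ++ₛ z, t) := by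
    intro i z t
    simp only [hk, Equiv.Perm.mul_apply]
    cases i
    · rw [sig_fix (by decide) (by decide), sig_left (by decide)]
    · rw [sig_left (by decide), sig_fix (by decide) (by decide)]
  have k1 : ∀ i z t, k ([false, i, true] ++ₛ z, t) = ([false, i, false] ++ₛ z, t) := by
    intro i z t
    simp only [hk, Equiv.Perm.mul_apply]
    cases i
    · rw [sig_fix (by decide) (by decide), sig_right (by decide)]
    · rw [sig_right (by decide), sig_fix (by decide) (by decide)]
  have kt : ∀ j z t, k ([true, j] ++ₛ z, t) = ([true, j] ++ₛ z, t) := by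
    intro j z t
    simp only [hk, Equiv.Perm.mul_apply]
    cases j
    · rw [sig_fix (by decide) (by decide), sig_fix (by decide) (by decide)]
    · rw [sig_fix (by decide) (by decide), sig_fix (by decide) (by decide)]
  have ki0 : ∀ i z t, k⁻¹ ([false, i, false] ++ₛ z, t) = ([false, i, true] ++ₛ z, t) := by
    intro i z t; rw [Equiv.Perm.inv_eq_iff_eq, k1]
  have ki1 : ∀ i z t, k⁻¹ ([false, i, true] ++ₛ z, t) = ([false, i, false] ++ₛ z, t) := by
    intro i z t; rw [Equiv.Perm.inv_eq_iff_eq, k0]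
  have kit : ∀ j z t, k⁻¹ ([true, j] ++ₛ z, t) = ([true, j] ++ₛ z, t) := by
    intro i z t; rw [Equiv.Perm.inv_eq_iff_eq, kt]
  set y0 := q * y * q⁻¹ with hy0'
  set y1 := k * y0 * k⁻¹ with hy1'
  -- points off the image cones are fixed by y0
  have off : ∀ p : Om L, (∀ i z t, p ≠ ([false, i, false] ++ₛ z, t)) → y0 p = p := by
    intro p hp
    rcases hqp : q⁻¹ p with ⟨c, t⟩
    have hpq : p = q (c, t) := by rw [← hqp]; simp
    obtain ⟨i, j, z, rfl⟩ := stream_split2 c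
    cases i with
    | false =>
      rw [q0] at hpq
      exact absurd hpq (hp _ _ _)
    | true =>
      rw [hy0', Equiv.Perm.mul_apply, Equiv.Perm.mul_apply, hqp, hy1, ← hpq]
  have y0t : ∀ j z t, y0 ([true, j] ++ₛ z, t) = ([true, j] ++ₛ z, t) := by
    intro j z t
    apply off
    intro i z' t' e
    have := congrArg (Stream'.take 1) (congrArg Prod.fst e)
    simp [Stream'.take] at this
  have y01 : ∀ i z t, y0 ([false, i, true] ++ₛ z, t) = ([false, i, true] ++ₛ z, t) := by
    intro j z t
    apply off
    intro i z' t' e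
    have := app_len_inj (u := [false, j, true]) (v := [false, i, false]) (congrArg Prod.fst e) rfl
    simp at this
  have hyy : y = y0 * y1 := by
    ext1 ⟨c, t⟩
    obtain ⟨i, j, z, rfl⟩ := stream_split2 c
    rw [hy1']
    simp only [Equiv.Perm.mul_apply]
    cases i with
    | true => rw [kit, y0t, kt, y0t, hy1]
    | false =>
      obtain ⟨b, z, rfl⟩ : ∃ (b : Bool) (z' : Stream' Bool), z = [b] ++ₛ z' :=
        ⟨z.head, z.tail, (Stream'.eta z).symm⟩
      obtain ⟨j', t', hj⟩ := hy0 j t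
      have y00 : ∀ z, y0 ([false, j, false] ++ₛ z, t) = ([false, j', false] ++ₛ z, t') := by
        intro z
        rw [hy0', Equiv.Perm.mul_apply, Equiv.Perm.mul_apply, qi0, hj, q0]
      rw [hj]
      cases b with
      | false =>
        change _ = y0 (k (y0 (k⁻¹ ([false, j, false] ++ₛ z, t))))
        rw [ki0, y01, k1, y00]; rfl
      | true =>
        change _ = y0 (k (y0 (k⁻¹ ([false, j, true] ++ₛ z, t))))
        rw [ki1, y00, k0, y01]; rfl
  have m1 : y1 ∈ N := by
    have h1 := comm_mem ρ hN hρ hf hfN hf1 hqH (inv_mem hy) (r := [true, true]) rfl q11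
      (fun z t => by rw [Equiv.Perm.inv_eq_iff_eq, hy1])
    have : q * y⁻¹ * q⁻¹ * y⁻¹⁻¹ = y1 := by
      have h2 : y1 = y0⁻¹ * y := by rw [hyy]; group
      rw [h2, hy0']; group
    rwa [this] at h1
  have m0 : y0 ∈ N := by
    have h1 := hN _ (inv_mem hkH) _ m1
    have : k⁻¹ * y1 * k⁻¹⁻¹ = y0 := by rw [hy1']; group
    rwa [this] at h1
  rw [hyy]
  exact mul_mem m0 m1

theorem HH_le_N (hN : ∀ h ∈ HH ρ, ∀ x ∈ N, h * x * h⁻¹ ∈ N) [Infinite L] (hρ : Function.Surjective ρ) {f : Equiv.Perm (Om L)} (hf : f ∈ HH ρ)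
    (hfN : f ∈ N) (hf1 : f ≠ 1) : HH ρ ≤ N := by
  rw [HH, Subgroup.closure_le]
  rintro x ⟨s, hs, rfl⟩
  have hs' := hs
  simp only [Set.mem_ofPred_eq, genList, List.mem_append, List.mem_map, List.mem_cons] at hs
  rcases hs with ⟨p, hp, rfl⟩ | rfl | ⟨j, -, rfl⟩
  · have := (mem_swPairs p).1 hp
    exact sig_mem_N ρ hN hρ hf hfN hf1 this.1 (by omega) (by omega)
  · refine local_mem_N ρ hN hρ hf hfN hf1 (iota_mem ρ) iota_1 ?_
    intro i t
    cases i with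
    | true => exact ⟨_, _, fun z => iota_01 z t⟩
    | false =>
      by_cases h : t.head? = some 1
      · cases t with
        | nil => simp at h
        | cons s t =>
          have : s = 1 := by simpa using h
          subst this
          exact ⟨_, _, fun z => iota_001 z t⟩
      · exact ⟨_, _, fun z => iota_00 z t h⟩
  · refine local_mem_N ρ hN hρ hf hfN hf1 (lab_mem ρ hρ _) (fun k z t => lab_else _ _ _ (by simp) z t) ?_
    intro i t
    cases i with
    | true => exact ⟨_, _, fun z => lab_else _ _ _ (by simp) z t⟩
    | false => exact ⟨_, _, fun z => lab_00 _ z t⟩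

theorem HH_simple [Infinite L] (hρ : Function.Surjective ρ) : IsSimpleGroup (HH ρ) := by
  have hnt : Nontrivial (HH ρ) := (phiH_frattini ρ hρ).1.nontrivial
  refine ⟨fun M hM => ?_⟩
  by_cases hb : M = ⊥
  · exact Or.inl hb
  right
  obtain ⟨f, hfM, hf1⟩ := Subgroup.ne_bot_iff_exists_ne_one.1 hb |>.elim fun f hf => 
    (⟨f.1, f.2, fun h => hf (Subtype.ext h)⟩ : ∃ f : HH ρ, f ∈ M ∧ f ≠ 1)
  have key := HH_le_N ρ (N := M.map (HH ρ).subtype) (by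
    rintro h hh x ⟨y, hy, rfl⟩
    exact ⟨⟨h, hh⟩ * y * ⟨h, hh⟩⁻¹, hM.conj_mem y hy _, rfl⟩) hρ f.2 ⟨f, hfM, rfl⟩
    (fun h => hf1 (Subtype.ext h))
  rw [eq_top_iff]
  rintro x -
  obtain ⟨y, hy, hyx⟩ := key x.2
  have : y = x := Subtype.ext hyx
  exact this ▸ hy

end Simple


section WPcomp

theorem comp_ite {α σ : Type*} [Primcodable α] [Primcodable σ] {c : α → Prop} [DecidablePred c]
    {f g : α → σ} (hc : Computable fun a => decide (c a)) (hf : Computable f) (hg : Computable g) :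
    Computable fun a => if c a then f a else g a :=
  (Computable.cond hc hf hg).of_eq fun a => by by_cases h : c a <;> simp [h]

theorem comp_decEq {α β : Type*} [Primcodable α] [Primcodable β] [DecidableEq β] {f g : α → β}
    (hf : Computable f) (hg : Computable g) : Computable fun a => decide (f a = g a) :=
  (PrimrecRel.decide (Primrec.eq (α := β))).to_comp.comp hf hg

variable {m : ℕ}

theorem primrec_swL : Primrec fun q : (List Bool × List Bool) × List Bool => swL q.1.1 q.1.2 q.2 := by
  have hu : Primrec fun q : (List Bool × List Bool) × List Bool => q.1.1 :=
    Primrec.fst.comp Primrec.fst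
  have hv : Primrec fun q : (List Bool × List Bool) × List Bool => q.1.2 :=
    Primrec.snd.comp Primrec.fst
  have ha : Primrec fun q : (List Bool × List Bool) × List Bool => q.2 := Primrec.snd
  have hlu := Primrec.list_length.comp hu
  have hlv := Primrec.list_length.comp hv
  unfold swL
  refine Primrec.ite (Primrec.eq.comp (Primrec.list_take.comp hlu ha) hu)
    (Primrec.list_append.comp hv (Primrec.list_drop.comp hlu ha)) ?_
  exact Primrec.ite (Primrec.eq.comp (Primrec.list_take.comp hlv ha) hv)
    (Primrec.list_append.comp hu (Primrec.list_drop.comp hlv ha)) ha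

theorem comp_stepI {dw : LW m → Bool} (hdw : Computable dw) : Computable (stepI dw) := by
  have h1 : Computable fun st : SSt m => st.1 := Computable.fst
  have hu : Computable fun st : SSt m => st.2.1 := Computable.fst.comp Computable.snd
  have hg : Computable fun st : SSt m => st.2.2 := Computable.snd.comp Computable.snd
  have ht : Computable fun st : SSt m => st.1.take 2 :=
    (Primrec.list_take.comp (Primrec.const 2) Primrec.id).to_comp.comp h1
  have hd : Computable fun st : SSt m => st.1.drop 2 :=
    (Primrec.list_drop.comp (Primrec.const 2) Primrec.id).to_comp.comp h1
  unfold stepI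
  refine comp_ite (comp_decEq ht (Computable.const _)) ?_ ?_
  · refine Computable.pair ?_ (Computable.pair (Computable.list_cons.comp (Computable.const _) hu) hg)
    exact Computable.list_cons.comp (Computable.const _) (Computable.list_cons.comp (Computable.const _) hd)
  refine comp_ite (comp_decEq ht (Computable.const _)) ?_ Computable.id
  refine comp_ite (comp_decEq hu (Computable.const _)) Computable.id ?_
  refine comp_ite (comp_decEq (hdw.comp (Primrec.list_headI.to_comp.comp hu)) (Computable.const true)) ?_
    Computable.id
  refine Computable.pair ?_ (Computable.pair (Primrec.list_tail.to_comp.comp hu) hg)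
  exact Computable.list_cons.comp (Computable.const _) (Computable.list_cons.comp (Computable.const _) hd)

theorem comp_stepP : Computable fun q : (Fin m × Bool) × SSt m => stepP q.1 q.2 := by
  have hp : Computable fun st : (Fin m × Bool) × SSt m => st.1 := Computable.fst
  have h1 : Computable fun st : (Fin m × Bool) × SSt m => st.2.1 := Computable.fst.comp Computable.snd
  have hu : Computable fun st : (Fin m × Bool) × SSt m => st.2.2.1 :=
    Computable.fst.comp (Computable.snd.comp Computable.snd)
  have hg : Computable fun st : (Fin m × Bool) × SSt m => st.2.2.2 :=
    Computable.snd.comp (Computable.snd.comp Computable.snd)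
  have ht : Computable fun st : (Fin m × Bool) × SSt m => st.2.1.take 2 :=
    (Primrec.list_take.comp (Primrec.const 2) Primrec.id).to_comp.comp h1
  unfold stepP
  refine comp_ite (comp_decEq ht (Computable.const _)) ?_ Computable.snd
  refine comp_ite (comp_decEq hu (Computable.const _)) ?_ ?_
  · exact Computable.pair h1 (Computable.pair (Computable.const _) (Computable.list_cons.comp hp hg))
  · refine Computable.pair h1 (Computable.pair ?_ hg)
    exact Computable.list_cons.comp (Computable.list_cons.comp hp (Primrec.list_headI.to_comp.comp hu))
      (Primrec.list_tail.to_comp.comp hu)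

theorem comp_step {dw : LW m → Bool} (hdw : Computable dw) :
    Computable fun q : SC m × SSt m => step dw q.1 q.2 := by
  have key : Computable fun q : SC m × SSt m => Sum.casesOn (motive := fun _ => SSt m) q.1
      (fun r => (swL r.1 r.2 q.2.1, q.2.2))
      (fun r => Sum.casesOn (motive := fun _ => SSt m) r (fun _ => stepI dw q.2) (fun p => stepP p q.2)) := by
    have a1 : Computable fun x : (SC m × SSt m) × (List Bool × List Bool) =>
        swL x.2.1 x.2.2 x.1.2.1 :=
      primrec_swL.to_comp.comp (g := fun x : (SC m × SSt m) × (List Bool × List Bool) => (x.2, x.1.2.1))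
        (Computable.pair Computable.snd
        (Computable.fst.comp (Computable.snd.comp Computable.fst)))
    have a2 : Computable fun x : (SC m × SSt m) × (List Bool × List Bool) => x.1.2.2 :=
      Computable.snd.comp (Computable.snd.comp Computable.fst)
    have a3 : Computable fun x : (SC m × SSt m) × (List Bool × List Bool) =>
        (swL x.2.1 x.2.2 x.1.2.1, x.1.2.2) := Computable.pair a1 a2
    have b1 : Computable fun x : ((SC m × SSt m) × (Unit ⊕ (Fin m × Bool))) × Unit =>
        stepI dw x.1.1.2 :=
      (comp_stepI hdw).comp (Computable.snd.comp (Computable.fst.comp Computable.fst))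
    have b2 : Computable fun x : ((SC m × SSt m) × (Unit ⊕ (Fin m × Bool))) × (Fin m × Bool) =>
        stepP x.2 x.1.1.2 :=
      comp_stepP.comp (g := fun x : ((SC m × SSt m) × (Unit ⊕ (Fin m × Bool))) × (Fin m × Bool) =>
        (x.2, x.1.1.2)) (Computable.pair Computable.snd
          (Computable.snd.comp (Computable.fst.comp Computable.fst)))
    have b3 : Computable fun x : (SC m × SSt m) × (Unit ⊕ (Fin m × Bool)) =>
        Sum.casesOn (motive := fun _ => SSt m) x.2 (fun _ => stepI dw x.1.2) (fun p => stepP p x.1.2) :=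
      Computable.sumCasesOn (f := fun x : (SC m × SSt m) × (Unit ⊕ (Fin m × Bool)) => x.2)
        (g := fun x _ => stepI dw x.1.2) (h := fun x p => stepP p x.1.2) Computable.snd b1 b2
    exact Computable.sumCasesOn (f := fun q : SC m × SSt m => q.1)
      (g := fun q r => (swL r.1 r.2 q.2.1, q.2.2))
      (h := fun q r => Sum.casesOn (motive := fun _ => SSt m) r (fun _ => stepI dw q.2)
        (fun p => stepP p q.2)) Computable.fst a3 b3
  refine key.of_eq ?_
  rintro ⟨q | u | p, st⟩ <;> rfl

theorem comp_sim {dw : LW m → Bool} (hdw : Computable dw) :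
    Computable fun q : List (SC m) × SSt m => sim dw q.1 q.2 :=
  comp_foldr (h := fun _ q => step dw q.1 q.2) Computable.fst Computable.snd
    ((comp_step hdw).comp Computable.snd)

/-- symbolic equality of lists of words -/
def eqLb (dw : LW m → Bool) (u v : List (LW m)) : Bool :=
  (decide (u.length = v.length)) &&
    (List.range u.length).all fun i => dw (u.getD i [] ++ FreeGroup.invRev (v.getD i []))

theorem comp_eqLb {dw : LW m → Bool} (hdw : Computable dw) :
    Computable fun q : List (LW m) × List (LW m) => eqLb dw q.1 q.2 := by
  unfold eqLb
  refine comp_and (comp_decEq (Computable.list_length.comp Computable.fst)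
    (Computable.list_length.comp Computable.snd)) ?_
  refine comp_all (Primrec.list_range.to_comp.comp (Computable.list_length.comp Computable.fst)) ?_
  refine hdw.comp (Computable.list_append.comp ?_ ?_)
  · exact (Primrec.list_getD []).to_comp.comp (Computable.fst.comp Computable.fst) Computable.snd
  · have h : Primrec (FreeGroup.invRev : LW m → LW m) := by
      unfold FreeGroup.invRev
      exact Primrec.list_reverse.comp (Primrec.list_map Primrec.id
        ((Primrec.dom_finite (fun g : Fin m × Bool => (g.1, !g.2))).comp Primrec.snd).to₂)
    exact h.to_comp.comp ((Primrec.list_getD []).to_comp.comp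
      (Computable.snd.comp Computable.fst) Computable.snd)

/-- code of a letter -/
def codeL (p : Fin (genList m).length × Bool) : SC m :=
  if p.2 then (genList m).get p.1 else invSC ((genList m).get p.1)

/-- one test -/
def chk1 (dw : LW m → Bool) (W : List (SC m)) (st : SSt m) : Bool :=
  (decide ((sim dw W st).1 = st.1)) && (eqLb dw (sim dw W st).2.1 st.2.1 && dw (sim dw W st).2.2)

theorem comp_chk1_aux {dw : LW m → Bool} (hdw : Computable dw) {α : Type} [Primcodable α]
    {S T : α → SSt m} (hs : Computable S) (ht : Computable T) :
    Computable fun q : α => decide ((S q).1 = (T q).1) && (eqLb dw (S q).2.1 (T q).2.1 && dw (S q).2.2) := by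
  have h1 : Computable fun q => (S q).1 := Computable.fst.comp hs
  have h2 : Computable fun q => (S q).2.1 := Computable.fst.comp (Computable.snd.comp hs)
  have h3 : Computable fun q => (S q).2.2 := Computable.snd.comp (Computable.snd.comp hs)
  have h4 : Computable fun q => (T q).1 := Computable.fst.comp ht
  have h5 : Computable fun q => (T q).2.1 := Computable.fst.comp (Computable.snd.comp ht)
  have h6 : Computable fun q => eqLb dw (S q).2.1 (T q).2.1 :=
    (comp_eqLb hdw).comp (Computable.pair h2 h5)
  exact comp_and (comp_decEq h1 h4) (comp_and h6 (hdw.comp h3))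

theorem comp_chk1 {dw : LW m → Bool} (hdw : Computable dw) :
    Computable fun q : List (SC m) × SSt m => chk1 dw q.1 q.2 :=
  comp_chk1_aux hdw (comp_sim hdw) Computable.snd

/-- full test -/
noncomputable def chk (dw : LW m → Bool) (W : List (SC m)) : Bool :=
  (enumLists [false, true] (W.length + 2)).all fun a =>
    (enumLists (enumLists (Finset.univ.toList : LW m) W.length) W.length).all fun u =>
      if a.length = W.length + 2 then chk1 dw W (a, u, []) else true

theorem comp_chk {dw : LW m → Bool} (hdw : Computable dw) : Computable (chk dw) := by
  have hl : Computable fun W : List (SC m) => W.length := Computable.list_length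
  have hl2 : Computable fun W : List (SC m) => W.length + 2 :=
    (Primrec.nat_add.comp Primrec.id (Primrec.const 2)).to_comp.comp hl
  have a1 : Computable fun x : (List (SC m) × List Bool) × List (LW m) =>
      decide (x.1.2.length = x.1.1.length + 2) :=
    comp_decEq (Computable.list_length.comp (Computable.snd.comp Computable.fst))
      (hl2.comp (Computable.fst.comp Computable.fst))
  have a2 : Computable fun x : (List (SC m) × List Bool) × List (LW m) =>
      chk1 dw x.1.1 (x.1.2, x.2, []) :=
    (comp_chk1 hdw).comp (g := fun x : (List (SC m) × List Bool) × List (LW m) =>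
      (x.1.1, (x.1.2, x.2, []))) (Computable.pair (Computable.fst.comp Computable.fst)
      (Computable.pair (Computable.snd.comp Computable.fst)
        (Computable.pair Computable.snd (Computable.const _))))
  have a3 : Computable fun x : (List (SC m) × List Bool) × List (LW m) =>
      (if x.1.2.length = x.1.1.length + 2 then chk1 dw x.1.1 (x.1.2, x.2, []) else true : Bool) :=
    comp_ite a1 a2 (Computable.const true)
  have h : Computable fun x : List (SC m) × List Bool => x.1.length := hl.comp Computable.fst
  have a4 : Computable fun x : List (SC m) × List Bool =>
      enumLists (enumLists (Finset.univ.toList : LW m) x.1.length) x.1.length :=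
    primrec_enumLists.to_comp.comp (primrec_enumLists.to_comp.comp (Computable.const _) h) h
  have a5 := comp_all (p := fun (x : List (SC m) × List Bool) (u : List (LW m)) =>
    (if x.2.length = x.1.length + 2 then chk1 dw x.1 (x.2, u, []) else true : Bool)) a4 a3
  exact comp_all (f := fun W : List (SC m) => enumLists [false, true] (W.length + 2))
    (primrec_enumLists.to_comp.comp (Computable.const _) hl2) a5

variable {L : Type} [Group L] (ρ : FreeGroup (Fin m) →* L)

theorem ev_invRev (w : LW m) : ev ρ (FreeGroup.invRev w) = (ev ρ w)⁻¹ := by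
  rw [ev, ev, ← map_inv, FreeGroup.inv_mk]

theorem eqLb_iff {dw : LW m → Bool} (hdw : ∀ w, dw w = true ↔ ev ρ w = 1) (u v : List (LW m)) :
    eqLb dw u v = true ↔ u.map (ev ρ) = v.map (ev ρ) := by
  unfold eqLb
  rw [Bool.and_eq_true, decide_eq_true_eq, List.all_eq_true]
  simp only [List.mem_range, hdw, ev_append, ev_invRev, mul_inv_eq_one]
  constructor
  · rintro ⟨h1, h2⟩
    apply List.ext_getElem (by simpa using h1)
    intro i hi hi'
    simp only [List.length_map] at hi hi'
    have := h2 i hi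
    simpa [hi, hi'] using this
  · intro h
    have h1 : u.length = v.length := by simpa using congrArg List.length h
    refine ⟨h1, fun i hi => ?_⟩
    have := congrArg (fun l => l[i]?) h
    have hi' : i < v.length := by omega
    simpa [hi, hi'] using this

theorem codeL_good (p : Fin (genList m).length × Bool) : GoodSC (codeL p) := by
  unfold codeL
  split_ifs
  · exact genList_good (List.get_mem _ _)
  · exact (genList_good (List.get_mem _ _)).inv

theorem rhoH_mk (w : LW (genList m).length) :
    (rhoH ρ (FreeGroup.mk w) : Equiv.Perm (Om L)) = ((w.map codeL).map (act ρ)).prod := by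
  rw [rhoH, FreeGroup.lift_mk, Subgroup.val_list_prod, List.map_map, List.map_map]
  congr 1
  apply List.map_congr_left
  rintro ⟨k, b⟩ -
  cases b
  · simp [codeL, act_invSC, genH]
  · simp [codeL, genH]

theorem app_all_inj {a b : List Bool} (h : ∀ z, a ++ₛ z = b ++ₛ z) : a = b := by
  have aux : ∀ (b : List Bool), (∀ z, b ++ₛ z = z) → b = [] := by
    intro b hb
    cases b with
    | nil => rfl
    | cons i b =>
      have h1 := congrArg Stream'.head (hb (Stream'.const (!i)))
      have h2 : i = !i := h1
      cases i <;> simp at h2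
  rcases le_total a.length b.length with hl | hl
  · obtain ⟨c, rfl⟩ := prefix_of_app (h (Stream'.const false)) hl
    rw [aux c, List.append_nil]
    intro z
    have := h z
    rw [Stream'.append_append_stream] at this
    exact (app_inj this).symm
  · obtain ⟨c, rfl⟩ := prefix_of_app (h (Stream'.const false)).symm hl
    rw [aux c, List.append_nil]
    intro z
    have := h z
    rw [Stream'.append_append_stream] at this
    exact app_inj this

theorem split_letters (N k : ℕ) (x : List L) : ∃ (u : List (LW m)) (rest : List L),
    u.length ≤ k ∧ (∀ w ∈ u, w.length ≤ N) ∧ x = u.map (ev ρ) ++ rest ∧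
    (rest = [] ∨ k ≤ u.length ∨
      ∃ s t, rest = s :: t ∧ ∀ w : LW m, w.length ≤ N → ev ρ w * (ev ρ [] * s) ≠ 1) := by
  induction k generalizing x with
  | zero => exact ⟨[], x, by simp, by simp, by simp, by simp⟩
  | succ k ih =>
    cases x with
    | nil => exact ⟨[], [], by simp, by simp, by simp, by simp⟩
    | cons s t =>
      by_cases hs : ∃ w : LW m, w.length ≤ N ∧ ev ρ w * s = 1
      · obtain ⟨w, hw, h⟩ := hs
        obtain ⟨u, rest, h1, h2, h3, h4⟩ := ih t
        refine ⟨FreeGroup.invRev w :: u, rest, by simpa using h1, ?_, ?_, ?_⟩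
        · intro v hv
          rcases List.mem_cons.1 hv with rfl | hv
          · rw [FreeGroup.invRev_length]; exact hw
          · exact h2 v hv
        · rw [List.map_cons, ev_invRev, List.cons_append, ← h3]
          rw [eq_inv_of_mul_eq_one_right h]
        · rcases h4 with h | h | h
          · exact Or.inl h
          · exact Or.inr (Or.inl (by simpa using h))
          · exact Or.inr (Or.inr h)
      · push Not at hs
        refine ⟨[], s :: t, by simp, by simp, by simp, Or.inr (Or.inr ⟨s, t, rfl, ?_⟩)⟩
        simpa [ev_nil] using hs

theorem chk_iff [Infinite L] {dw : LW m → Bool} (hdw : ∀ w, dw w = true ↔ ev ρ w = 1)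
    {W : List (SC m)} (hW : ∀ s ∈ W, GoodSC s) :
    chk dw W = true ↔ (W.map (act ρ)).prod = 1 := by
  unfold chk
  simp only [List.all_eq_true]
  constructor
  · intro h
    ext1 ⟨c, x⟩
    obtain ⟨a, z, ha, rfl⟩ := stream_split (W.length + 2) c
    obtain ⟨u, rest, h1, h2, h3, h4⟩ := split_letters ρ W.length W.length x
    have h5 := h a ((mem_enumLists _ _ _).2 ⟨ha.le, by intro b _; cases b <;> simp⟩) u
      ((mem_enumLists _ _ _).2 ⟨h1, fun w hw => (mem_enumLists _ _ _).2 ⟨h2 w hw, by simp⟩⟩)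
    rw [if_pos ha] at h5
    unfold chk1 at h5
    simp only [Bool.and_eq_true, decide_eq_true_eq, eqLb_iff ρ hdw, hdw] at h5
    obtain ⟨e1, e2, e3⟩ := h5
    have e : ((a ++ₛ z, x) : Om L) = real ρ (a, u, []) z rest := by
      simp only [real, ev_nil, labH_one, h3]
    rw [e, sim_real ρ hdw (st := (a, u, [])) hW ha.ge h4 z]
    simp only [real, e1, e2, e3, ev_nil, Equiv.Perm.coe_one, id]
  · intro h a ha u hu
    split_ifs with hl
    swap
    · rfl
    unfold chk1
    simp only [Bool.and_eq_true, decide_eq_true_eq, eqLb_iff ρ hdw, hdw]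
    have key : ∀ (rest : List L) (hc : Cond ρ W.length u [] rest) (z : Stream' Bool),
        real ρ (sim dw W (a, u, [])) z rest = real ρ (a, u, []) z rest := by
      intro rest hc z
      rw [← sim_real ρ hdw hW hl.ge hc z, h]; rfl
    have k1 := key [] (Or.inl rfl)
    simp only [real, labH, List.append_nil, Prod.mk.injEq] at k1
    obtain ⟨s, hs⟩ := exists_generic (badSet_finite ρ W.length)
    have k2 := congrArg Prod.snd (key [s] (Or.inr (Or.inr ⟨s, [], rfl, fun w hw hw' =>
      hs ⟨w, hw, by simpa [ev_nil] using hw'⟩⟩)) (Stream'.const false))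
    refine ⟨app_all_inj fun z => (k1 z).1, (k1 (Stream'.const false)).2, ?_⟩
    simp only [real, (k1 (Stream'.const false)).2, labH, ev_nil] at k2
    simpa using k2

theorem rhoH_decidable [Infinite L] (hd : DecidableWordProblemVia ρ) :
    DecidableWordProblemVia (rhoH ρ) := by
  obtain ⟨dw, hc, hdw⟩ := pred_to_bool hd
  refine computable_of_pred (fun w : LW (genList m).length => chk dw (w.map codeL)) ?_ ?_
  · exact (comp_chk hc).comp (Primrec.list_map Primrec.id
      ((Primrec.dom_finite codeL).comp Primrec.snd).to₂).to_comp
  · intro w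
    rw [chk_iff ρ hdw, ← rhoH_mk]
    · simp
    · intro s hs
      obtain ⟨p, -, rfl⟩ := List.mem_map.1 hs
      exact codeL_good p

theorem stepB [Infinite L] (hρ : Function.Surjective ρ) (hd : DecidableWordProblemVia ρ) :
    ∃ (H : Type) (_ : Group H), Group.FG H ∧ IsSimpleGroup H ∧
      (∃ (m : ℕ) (ρ : FreeGroup (Fin m) →* H),
        Function.Surjective ρ ∧ DecidableWordProblemVia ρ) ∧
      ∃ φ : L →* H, IsFrattini φ ∧ ∀ Z : Finset L, Generates Z →
        ∃ Y : Finset H, Generates Y ∧ IsQIEmbedding Z Y φ := by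
  refine ⟨HH ρ, inferInstance, ?_, HH_simple ρ hρ, ⟨_, rhoH ρ, rhoH_surj ρ, rhoH_decidable ρ hd⟩,
    phiH ρ hρ, phiH_frattini ρ hρ, fun Z hZ => phiH_qi ρ hρ hZ⟩
  exact Group.fg_of_surjective (rhoH_surj ρ)

end WPcomp


section LineGroup

/-- index of the label on a row of the line, if any -/
def labN (n : ℕ) : Option ℕ := if (Nat.unpair n).1 = 0 then some (Nat.unpair n).2 else none

theorem labN_iff (n k : ℕ) : labN n = some k ↔ n = k * k := by
  have hp : Nat.pair 0 k = k * k := by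
    unfold Nat.pair
    rcases Nat.eq_zero_or_pos k with rfl | h
    · simp
    · simp [h]
  unfold labN
  constructor
  · intro h
    split_ifs at h with h1
    have h2 : (Nat.unpair n).2 = k := by simpa using h
    rw [← hp, ← h1, ← h2, Nat.pair_unpair]
  · rintro rfl
    rw [← hp, Nat.unpair_pair]; simp

/-- label on integer rows -/
def labZ (i : ℤ) : Option ℕ := if 0 ≤ i then labN i.toNat else none

theorem labZ_iff (i : ℤ) (k : ℕ) : labZ i = some k ↔ i = (k : ℤ) * k := by
  unfold labZ
  split_ifs with h
  · rw [labN_iff]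
    constructor
    · intro h1
      have := congrArg (Nat.cast : ℕ → ℤ) h1
      rw [Int.toNat_of_nonneg h] at this
      simpa using this
    · rintro rfl
      have : ((k : ℤ) * k) = ((k * k : ℕ) : ℤ) := by push_cast; rfl
      rw [this, Int.toNat_natCast]
  · constructor
    · intro h1; cases h1
    · rintro rfl
      exact absurd (mul_self_nonneg _) h

variable {K : Type} [Group K] (x : ℕ → K)

/-- the letter value -/
def xb (k : ℕ) (b : Bool) : K := if b then x k else (x k)⁻¹

/-- sign -/
def sg (b : Bool) : ℤ := if b then 1 else -1

/-- multiplier -/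
def lam (i : ℤ) (b : Bool) : K := (labZ i).elim 1 (fun k => xb x k b)

theorem lam_not (i : ℤ) (b : Bool) : lam x i (!b) * lam x i b = 1 := by
  unfold lam
  cases labZ i with
  | none => simp
  | some k => cases b <;> simp [xb]

/-- action of letters -/
def aL (l : Fin 3 × Bool) (p : ℤ × ℤ × K) : ℤ × ℤ × K :=
  if l.1 = 0 then (p.1 + sg l.2, p.2.1, p.2.2)
  else if l.1 = 1 then (p.1, if p.1 = 0 then p.2.1 + sg l.2 else p.2.1, p.2.2)
  else (p.1, p.2.1, if 0 ≤ p.2.1 then lam x p.1 l.2 * p.2.2 else p.2.2)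

theorem aL_not (g : Fin 3) (b : Bool) (p : ℤ × ℤ × K) : aL x (g, !b) (aL x (g, b) p) = p := by
  obtain ⟨i, j, k⟩ := p
  unfold aL
  by_cases h0 : g = 0
  · cases b <;> simp [h0, sg]
  by_cases h1 : g = 1
  · by_cases hi : i = 0 <;> cases b <;> simp [h1, sg, hi]
  · simp only [h0, h1, if_false]
    by_cases hj : 0 ≤ j
    · simp [hj, ← mul_assoc, lam_not]
    · simp [hj]

/-- letters as permutations -/
def genP (g : Fin 3) : Equiv.Perm (ℤ × ℤ × K) where
  toFun := aL x (g, true)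
  invFun := aL x (g, false)
  left_inv := aL_not x g true
  right_inv := aL_not x g false

/-- letters with sign as permutations -/
def letP (l : Fin 3 × Bool) : Equiv.Perm (ℤ × ℤ × K) := if l.2 then genP x l.1 else (genP x l.1)⁻¹

theorem letP_apply (l : Fin 3 × Bool) (p : ℤ × ℤ × K) : letP x l p = aL x l p := by
  obtain ⟨g, b⟩ := l
  cases b <;> rfl

/-- the group on the line -/
def LL : Subgroup (Equiv.Perm (ℤ × ℤ × K)) := Subgroup.closure (Set.range (genP x))

/-- generators -/
def genL (g : Fin 3) : LL x := ⟨genP x g, Subgroup.subset_closure ⟨g, rfl⟩⟩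

theorem genL_closure : Subgroup.closure (Set.range (genL x)) = ⊤ := by
  have h := Subgroup.closure_closure_coe_preimage (k := Set.range (genP x))
  have h2 : Set.range (genL x) = ((↑) : LL x → Equiv.Perm (ℤ × ℤ × K)) ⁻¹' (Set.range (genP x)) := by
    ext ⟨f, hf⟩
    constructor
    · rintro ⟨k, hk⟩
      exact ⟨k, congrArg Subtype.val hk⟩
    · rintro ⟨s, hs⟩
      exact ⟨s, Subtype.ext hs⟩
  rw [h2]; exact h

/-- presentation -/
def rhoL : FreeGroup (Fin 3) →* LL x := FreeGroup.lift (genL x)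

theorem rhoL_surj : Function.Surjective (rhoL x) := by
  rw [← MonoidHom.range_eq_top, rhoL, FreeGroup.range_lift_eq_closure, genL_closure]

theorem rhoL_mk (w : List (Fin 3 × Bool)) :
    (rhoL x (FreeGroup.mk w) : Equiv.Perm (ℤ × ℤ × K)) = (w.map (letP x)).prod := by
  rw [rhoL, FreeGroup.lift_mk, Subgroup.val_list_prod, List.map_map]
  congr 1
  apply List.map_congr_left
  rintro ⟨k, b⟩ -
  cases b
  · simp [letP, genL]
  · simp [letP, genL]

/-- symbolic step on the line -/
def stZ (l : Fin 3 × Bool) (s : ℤ × ℤ × List (ℕ × Bool)) : ℤ × ℤ × List (ℕ × Bool) :=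
  if l.1 = 0 then (s.1 + sg l.2, s.2.1, s.2.2)
  else if l.1 = 1 then (s.1, if s.1 = 0 then s.2.1 + sg l.2 else s.2.1, s.2.2)
  else (s.1, s.2.1, if 0 ≤ s.2.1 then (labZ s.1).elim s.2.2 (fun k => (k, l.2) :: s.2.2) else s.2.2)

/-- symbolic run on the line -/
def runZ (w : List (Fin 3 × Bool)) (i j : ℤ) : ℤ × ℤ × List (ℕ × Bool) := w.foldr stZ (i, j, [])

theorem evalWord_cons (k : ℕ) (b : Bool) (o : List (ℕ × Bool)) :
    evalWord x ((k, b) :: o) = xb x k b * evalWord x o := by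
  simp [evalWord, xb]

theorem run_apply (w : List (Fin 3 × Bool)) (i j : ℤ) (k : K) : (w.map (letP x)).prod (i, j, k) =
    ((runZ w i j).1, (runZ w i j).2.1, evalWord x (runZ w i j).2.2 * k) := by
  induction w with
  | nil => simp [runZ, evalWord]
  | cons l w ih =>
    rw [List.map_cons, List.prod_cons, Equiv.Perm.mul_apply, ih, letP_apply]
    have e : runZ (l :: w) i j = stZ l (runZ w i j) := rfl
    rw [e]
    generalize runZ w i j = s
    obtain ⟨i', j', o⟩ := s
    unfold aL stZ
    by_cases h0 : l.1 = 0
    · simp [h0]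
    by_cases h1 : l.1 = 1
    · simp [h1]
    simp only [h0, h1, if_false]
    by_cases hj : 0 ≤ j'
    · simp only [hj, if_true]
      unfold lam
      cases h : labZ i' with
      | none => simp
      | some n => simp [evalWord_cons, mul_assoc]
    · simp [hj]

theorem rhoL_one_iff (w : List (Fin 3 × Bool)) : rhoL x (FreeGroup.mk w) = 1 ↔
    ∀ i j, (runZ w i j).1 = i ∧ (runZ w i j).2.1 = j ∧ evalWord x (runZ w i j).2.2 = 1 := by
  have h : rhoL x (FreeGroup.mk w) = 1 ↔ (w.map (letP x)).prod = 1 := by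
    rw [← rhoL_mk]; simp
  rw [h]
  constructor
  · intro h i j
    have := run_apply x w i j 1
    rw [h] at this
    simp only [Equiv.Perm.coe_one, id, mul_one, Prod.mk.injEq] at this
    exact ⟨this.1.symm, this.2.1.symm, this.2.2.symm⟩
  · intro h
    ext1 ⟨i, j, k⟩
    obtain ⟨h1, h2, h3⟩ := h i j
    rw [run_apply, h1, h2, h3]; simp

theorem LL_form (h : LL x) (i j : ℤ) : ∃ i' j' o, ∀ k, h.1 (i, j, k) = (i', j', o * k) := by
  obtain ⟨f, rfl⟩ := rhoL_surj x h
  obtain ⟨w, rfl⟩ : ∃ w, FreeGroup.mk w = f := ⟨f.toWord, FreeGroup.mk_toWord⟩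
  exact ⟨_, _, _, fun k => by rw [rhoL_mk, run_apply]⟩

/-- the basic embedding -/
def P0f (a : K) (p : ℤ × ℤ × K) : ℤ × ℤ × K :=
  (p.1, p.2.1, if p.1 = 0 ∧ p.2.1 = 0 then a * p.2.2 else p.2.2)

theorem P0f_mul (a b : K) (p : ℤ × ℤ × K) : P0f a (P0f b p) = P0f (a * b) p := by
  unfold P0f
  by_cases h : p.1 = 0 ∧ p.2.1 = 0 <;> simp [h, mul_assoc]

theorem P0f_one (p : ℤ × ℤ × K) : P0f 1 p = p := by simp [P0f]

/-- the basic embedding as a homomorphism -/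
def P0h : K →* Equiv.Perm (ℤ × ℤ × K) where
  toFun a := ⟨P0f a, P0f a⁻¹, fun p => by rw [P0f_mul]; simp [P0f_one],
    fun p => by rw [P0f_mul]; simp [P0f_one]⟩
  map_one' := Equiv.ext fun p => P0f_one p
  map_mul' a b := Equiv.ext fun p => (P0f_mul a b p).symm

theorem P0h_apply (a : K) (p : ℤ × ℤ × K) : P0h a p = P0f a p := rfl

theorem genP0_pow (n : ℕ) (i j : ℤ) (k : K) : (genP x 0 ^ n) (i, j, k) = (i + n, j, k) := by
  induction n with
  | zero => simp
  | succ n ih =>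
    rw [pow_succ', Equiv.Perm.mul_apply, ih]
    simp [genP, aL, sg, add_assoc]

theorem P0h_x_mem (m : ℕ) : P0h (x m) ∈ LL x := by
  have hg : ∀ g, genP x g ∈ LL x := fun g => Subgroup.subset_closure ⟨g, rfl⟩
  set y := (genP x 0 ^ (m * m))⁻¹ * genP x 2 * genP x 0 ^ (m * m) with hy
  have hym : y ∈ LL x := mul_mem (mul_mem (inv_mem (pow_mem (hg 0) _)) (hg 2)) (pow_mem (hg 0) _)
  have hya : ∀ i j k, y (i, j, k) = (i, j, if 0 ≤ j then lam x (i + m * m) true * k else k) := by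
    intro i j k
    rw [hy, Equiv.Perm.mul_apply, Equiv.Perm.mul_apply, genP0_pow, Equiv.Perm.inv_eq_iff_eq, genP0_pow]
    simp [genP, aL]
  have hyi : ∀ i j k, y⁻¹ (i, j, k) = (i, j, if 0 ≤ j then (lam x (i + m * m) true)⁻¹ * k else k) := by
    intro i j k
    rw [Equiv.Perm.inv_eq_iff_eq, hya]
    by_cases h : 0 ≤ j <;> simp [h]
  have hz : ∀ i j k, genP x 1 (i, j, k) = (i, if i = 0 then j + 1 else j, k) := by
    intro i j k; simp [genP, aL, sg]
  have hzi : ∀ i j k, (genP x 1)⁻¹ (i, j, k) = (i, if i = 0 then j - 1 else j, k) := by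
    intro i j k
    rw [Equiv.Perm.inv_eq_iff_eq, hz]
    by_cases h : i = 0 <;> simp [h]
  have : P0h (x m) = y * genP x 1 * y⁻¹ * (genP x 1)⁻¹ := by
    ext1 ⟨i, j, k⟩
    rw [Equiv.Perm.mul_apply, Equiv.Perm.mul_apply, Equiv.Perm.mul_apply, hzi, hyi, hz, hya, P0h_apply]
    unfold P0f
    by_cases hi : i = 0
    · subst hi
      have hl : lam x (0 + m * m) true = x m := by
        unfold lam
        rw [(labZ_iff _ m).2 (by simp)]; simp [xb]
      rw [hl]
      by_cases hj : j = 0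
      · subst hj; simp
      · by_cases hj2 : 0 ≤ j
        · have : 0 ≤ j - 1 := by omega
          simp [hj, hj2]
          intro h; omega
        · have : ¬ (0 ≤ j - 1) := by omega
          simp [hj, hj2]
          intro h; omega
    · by_cases hj2 : 0 ≤ j <;> simp [hi, hj2]
  rw [this]
  exact mul_mem (mul_mem (mul_mem hym (hg 1)) (inv_mem hym)) (inv_mem (hg 1))

theorem P0h_mem {a : K} (ha : a ∈ Subgroup.closure (Set.range x)) : P0h a ∈ LL x := by
  have : Subgroup.closure (Set.range x) ≤ (LL x).comap P0h := by
    rw [Subgroup.closure_le]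
    rintro _ ⟨m, rfl⟩
    exact P0h_x_mem x m
  exact this ha

theorem LL_infinite : Infinite (LL x) := by
  refine Infinite.of_injective (fun n : ℕ => genL x 0 ^ n) ?_
  intro a b hab
  have h1 : genP x 0 ^ a = genP x 0 ^ b := by
    have := congrArg Subtype.val hab
    simpa [genL] using this
  have h2 := congrArg (fun f => (f ((0 : ℤ), (0 : ℤ), (1 : K))).1) h1
  simpa [genP0_pow] using h2

theorem LL_embed {G : Type} [Group G] (s : G →* K) (p : K →* G) (hps : ∀ g, p (s g) = g)
    (hs : ∀ g, s g ∈ Subgroup.closure (Set.range x)) (hfin : (Set.range fun k => p (x k)).Finite)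
    {X : Finset G} (hX : Generates X) {Z : Finset (LL x)} (hZ : Generates Z)
    (hZ2 : ∀ y ∈ Z, ∃ g, y = genL x g) :
    ∃ φ : G →* LL x, IsQIEmbedding X Z φ ∧ IsFrattini φ := by
  have hmem : ∀ g, (P0h.comp s) g ∈ LL x := fun g => P0h_mem x (hs g)
  set φ : G →* LL x := (P0h.comp s).codRestrict (LL x) hmem with hφ
  have hφa : ∀ g k, (φ g).1 (0, 0, k) = (0, 0, s g * k) := by
    intro g k
    have : (φ g).1 (0, 0, k) = P0f (s g) (0, 0, k) := rfl
    rw [this]; simp [P0f]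
  refine ⟨φ, ?_, ?_⟩
  · refine qi_of_potential (Ω := ℤ × ℤ × K) hX hZ φ (fun q => p q.2.2)
      (insert 1 (Set.range fun k => p (x k))) (hfin.insert _) ?_ (0, 0, 1) ?_
    · rintro y hy ⟨i, j, k⟩
      obtain ⟨g, rfl⟩ := hZ2 y hy
      have e : genL x g • (i, j, k) = aL x (g, true) (i, j, k) := rfl
      rw [e]
      unfold aL
      by_cases h0 : g = 0
      · simp [h0]
      by_cases h1 : g = 1
      · simp [h1]
      simp only [h0, h1, if_false]
      by_cases hj : 0 ≤ j
      · simp only [hj, if_true, map_mul, mul_inv_cancel_right]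
        unfold lam
        cases labZ i with
        | none => simp
        | some n => right; exact ⟨n, by simp [xb]⟩
      · simp [hj]
    · intro g
      have e : φ g • ((0 : ℤ), (0 : ℤ), (1 : K)) = (φ g).1 (0, 0, 1) := rfl
      rw [e, hφa]; simp [hps]
  · have hinj : Function.Injective φ := by
      intro a b hab
      have h1 := hφa a 1
      rw [hab, hφa] at h1
      have h2 : s b = s a := by simpa using h1
      rw [← hps a, ← hps b, h2]
    apply frattini_of hinj
    intro a b c h
    obtain ⟨i', j', o, ho⟩ := LL_form x c 0 0
    have h1 : c.1 ((φ a).1 (0, 0, 1)) = (φ b).1 (c.1 (0, 0, 1)) :=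
      congrArg (fun f : LL x => f.1 ((0 : ℤ), (0 : ℤ), (1 : K))) h
    rw [hφa, ho, ho] at h1
    have h2 : (φ b).1 (i', j', o * 1) = P0f (s b) (i', j', o * 1) := rfl
    rw [h2] at h1
    unfold P0f at h1
    by_cases hij : i' = 0 ∧ j' = 0
    · have h3 : o * s a = s b * o := by simpa [hij] using h1
      rw [isConj_iff]
      refine ⟨p o, ?_⟩
      have h4 := congrArg p h3
      rw [map_mul, map_mul, hps, hps] at h4
      rw [h4]; group
    · have h3 : s a = 1 := by simpa [hij] using h1
      have ha : a = 1 := by rw [← hps a, h3, map_one]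
      subst ha
      rw [map_one, mul_one] at h
      have : φ b = 1 := mul_eq_right.1 h.symm
      have hb : b = 1 := hinj (by rw [this, map_one])
      rw [hb]

end LineGroup


section LineWP

theorem sg_bound (b : Bool) : -1 ≤ sg b ∧ sg b ≤ 1 := by cases b <;> simp [sg]

theorem couple (R : ℕ → ℕ → Prop) (w : List (Fin 3 × Bool)) (i j i2 j2 : ℤ) (N : ℕ)
    (hN : w.length ≤ N)
    (h0 : ∀ d : ℤ, -N ≤ d → d ≤ N → (i + d = 0 ↔ i2 + d = 0))
    (hl : ∀ d : ℤ, -N ≤ d → d ≤ N → (labZ (i + d) = none ∧ labZ (i2 + d) = none) ∨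
      ∃ k k2, labZ (i + d) = some k ∧ labZ (i2 + d) = some k2 ∧ R k k2)
    (hj : ∀ e : ℤ, -N ≤ e → e ≤ N → (0 ≤ j + e ↔ 0 ≤ j2 + e)) :
    ∃ (d e : ℤ) (o o2 : List (ℕ × Bool)), runZ w i j = (i + d, j + e, o) ∧
      runZ w i2 j2 = (i2 + d, j2 + e, o2) ∧ (-w.length ≤ d ∧ d ≤ w.length) ∧
      (-w.length ≤ e ∧ e ≤ w.length) ∧
      List.Forall₂ (fun p q : ℕ × Bool => R p.1 q.1 ∧ p.2 = q.2) o o2 := by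
  induction w with
  | nil => exact ⟨0, 0, [], [], by simp [runZ], by simp [runZ], by simp, by simp, by simp⟩
  | cons l w ih =>
    simp only [List.length_cons] at hN
    obtain ⟨d, e, o, o2, h1, h2, hd, he, hf⟩ := ih (by omega)
    have e1 : runZ (l :: w) i j = stZ l (runZ w i j) := rfl
    have e2 : runZ (l :: w) i2 j2 = stZ l (runZ w i2 j2) := rfl
    rw [e1, e2, h1, h2]
    have hs := sg_bound l.2
    simp only [List.length_cons, Nat.cast_add, Nat.cast_one]
    unfold stZ
    by_cases hl0 : l.1 = 0
    · refine ⟨d + sg l.2, e, o, o2, ?_, ?_, ⟨by omega, by omega⟩, ⟨by omega, by omega⟩, hf⟩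
      · simp [hl0, add_assoc]
      · simp [hl0, add_assoc]
    by_cases hl1 : l.1 = 1
    · have hh := h0 d (by omega) (by omega)
      by_cases hz : i + d = 0
      · have hz2 := hh.1 hz
        refine ⟨d, e + sg l.2, o, o2, ?_, ?_, ⟨by omega, by omega⟩, ⟨by omega, by omega⟩, hf⟩
        · simp [hl1, hz, add_assoc]
        · simp [hl1, hz2, add_assoc]
      · have hz2 : ¬ (i2 + d = 0) := fun h => hz (hh.2 h)
        refine ⟨d, e, o, o2, ?_, ?_, ⟨by omega, by omega⟩, ⟨by omega, by omega⟩, hf⟩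
        · simp [hl1, hz]
        · simp [hl1, hz2]
    · have hh := hj e (by omega) (by omega)
      simp only [hl0, hl1, if_false]
      by_cases hz : 0 ≤ j + e
      · have hz2 := hh.1 hz
        simp only [hz, hz2, if_true]
        rcases hl d (by omega) (by omega) with ⟨a1, a2⟩ | ⟨k, k2, a1, a2, hR⟩
        · rw [a1, a2]
          exact ⟨d, e, o, o2, rfl, rfl, ⟨by omega, by omega⟩, ⟨by omega, by omega⟩, hf⟩
        · rw [a1, a2]
          exact ⟨d, e, (k, l.2) :: o, (k2, l.2) :: o2, rfl, rfl, ⟨by omega, by omega⟩,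
            ⟨by omega, by omega⟩, List.Forall₂.cons ⟨hR, rfl⟩ hf⟩
      · have hz2 : ¬ (0 ≤ j2 + e) := fun h => hz (hh.2 h)
        simp only [hz, hz2, if_false]
        exact ⟨d, e, o, o2, rfl, rfl, ⟨by omega, by omega⟩, ⟨by omega, by omega⟩, hf⟩

variable {K : Type} [Group K] (x : ℕ → K)

/-- trivial behaviour from a start point -/
def GoodZ (w : List (Fin 3 × Bool)) (i j : ℤ) : Prop :=
  (runZ w i j).1 = i ∧ (runZ w i j).2.1 = j ∧ evalWord x (runZ w i j).2.2 = 1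

theorem good_of_couple {w : List (Fin 3 × Bool)} {i j i2 j2 : ℤ} {R : ℕ → ℕ → Prop}
    (hR : ∀ o o2 : List (ℕ × Bool), List.Forall₂ (fun p q : ℕ × Bool => R p.1 q.1 ∧ p.2 = q.2) o o2 →
      evalWord x o2 = 1 → evalWord x o = 1)
    (h0 : ∀ d : ℤ, -w.length ≤ d → d ≤ w.length → (i + d = 0 ↔ i2 + d = 0))
    (hl : ∀ d : ℤ, -w.length ≤ d → d ≤ w.length → (labZ (i + d) = none ∧ labZ (i2 + d) = none) ∨
      ∃ k k2, labZ (i + d) = some k ∧ labZ (i2 + d) = some k2 ∧ R k k2)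
    (hj : ∀ e : ℤ, -w.length ≤ e → e ≤ w.length → (0 ≤ j + e ↔ 0 ≤ j2 + e))
    (hg : GoodZ x w i2 j2) : GoodZ x w i j := by
  obtain ⟨d, e, o, o2, h1, h2, -, -, hf⟩ := couple R w i j i2 j2 w.length le_rfl h0 hl hj
  unfold GoodZ at *
  rw [h1]
  rw [h2] at hg
  obtain ⟨g1, g2, g3⟩ := hg
  refine ⟨?_, ?_, hR o o2 hf g3⟩
  · simp only at g1 ⊢; omega
  · simp only at g2 ⊢; omega

theorem hR_eq (o o2 : List (ℕ × Bool))
    (h : List.Forall₂ (fun p q : ℕ × Bool => p.1 = q.1 ∧ p.2 = q.2) o o2) : evalWord x o2 = 1 → evalWord x o = 1 := by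
  have : o = o2 := by
    induction h with
    | nil => rfl
    | cons h _ ih => rw [ih, Prod.ext h.1 h.2]
  rw [this]; exact id

theorem hR_single (hx : ∀ k (e : ℤ), x k ^ e = 1 → e = 0) (κ κ2 : ℕ) (o o2 : List (ℕ × Bool))
    (h : List.Forall₂ (fun p q : ℕ × Bool => (p.1 = κ ∧ q.1 = κ2) ∧ p.2 = q.2) o o2) :
    evalWord x o2 = 1 → evalWord x o = 1 := by
  have : ∃ c : ℤ, evalWord x o = x κ ^ c ∧ evalWord x o2 = x κ2 ^ c := by
    induction h with
    | nil => exact ⟨0, by simp [evalWord], by simp [evalWord]⟩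
    | @cons p q o o2 h _ ih =>
      obtain ⟨c, h1, h2⟩ := ih
      obtain ⟨k, b⟩ := p
      obtain ⟨k2, b2⟩ := q
      obtain ⟨⟨rfl, rfl⟩, h3⟩ := h
      simp only at h3
      subst h3
      refine ⟨sg b + c, ?_, ?_⟩
      · rw [evalWord_cons, h1, zpow_add]; cases b <;> simp [xb, sg]
      · rw [evalWord_cons, h2, zpow_add]; cases b <;> simp [xb, sg]
  obtain ⟨c, h1, h2⟩ := this
  intro h3
  rw [h2] at h3
  rw [h1, hx _ _ h3, zpow_zero]

theorem labZ_none {i : ℤ} (h : i < 0) : labZ i = none := by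
  unfold labZ; rw [if_neg (by omega)]

theorem sq_unique {a b : ℕ} {N : ℤ} (hN : 0 ≤ N) (ha : N + 1 ≤ a) (h1 : (a : ℤ) * a - b * b ≤ 2 * N)
    (h2 : -(2 * N) ≤ (a : ℤ) * a - b * b) : b = a := by
  rcases lt_trichotomy b a with h | h | h
  · exfalso
    have : (b : ℤ) + 1 ≤ a := by exact_mod_cast h
    have hb : (0 : ℤ) ≤ b := by positivity
    nlinarith
  · exact h
  · exfalso
    have : (a : ℤ) + 1 ≤ b := by exact_mod_cast h
    nlinarith

theorem good_finite (hx : ∀ k (e : ℤ), x k ^ e = 1 → e = 0) (w : List (Fin 3 × Bool))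
    (h : ∀ i j : ℤ, -w.length - 1 ≤ i → i ≤ (w.length + 1) * (w.length + 1) + w.length →
      -w.length - 1 ≤ j → j ≤ w.length → GoodZ x w i j) (i j : ℤ) : GoodZ x w i j := by
  obtain ⟨N, hN⟩ : ∃ N : ℤ, N = w.length := ⟨_, rfl⟩
  have hN0 : 0 ≤ N := by omega
  rw [← hN] at h
  -- reduction in the second coordinate
  have red : ∀ i : ℤ, -N - 1 ≤ i → i ≤ (N + 1) * (N + 1) + N → ∀ j, GoodZ x w i j := by
    intro i hi1 hi2 j
    have hlab : ∀ d : ℤ, -w.length ≤ d → d ≤ w.length → (labZ (i + d) = none ∧ labZ (i + d) = none) ∨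
      ∃ k k2, labZ (i + d) = some k ∧ labZ (i + d) = some k2 ∧ k = k2 := by
      intro d _ _
      cases hh : labZ (i + d) with
      | none => simp
      | some k => right; exact ⟨k, k, rfl, rfl, rfl⟩
    by_cases hj1 : j < -N - 1
    · exact good_of_couple x (R := fun a b => a = b) (i2 := i) (j2 := -N - 1) (hR_eq x)
        (fun d _ _ => Iff.rfl) hlab (fun e _ _ => by omega) (h i _ hi1 hi2 le_rfl (by omega))
    by_cases hj2 : N < j
    · exact good_of_couple x (R := fun a b => a = b) (i2 := i) (j2 := N) (hR_eq x)
        (fun d _ _ => Iff.rfl) hlab (fun e _ _ => by omega) (h i _ hi1 hi2 (by omega) le_rfl)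
    exact h i j hi1 hi2 (by omega) (by omega)
  have hsq : 0 ≤ (N + 1) * (N + 1) := mul_self_nonneg _
  have hsq2 : 2 * N < (N + 1) * (N + 1) := by nlinarith
  have base : ∀ j, GoodZ x w (-N - 1) j := red _ le_rfl (by omega)
  by_cases hi1 : i < -N - 1
  · refine good_of_couple x (R := fun a b => a = b) (i2 := -N - 1) (j2 := j) (hR_eq x)
      (fun d _ _ => by omega) (fun d _ _ => ?_) (fun e _ _ => Iff.rfl) (base j)
    left
    exact ⟨labZ_none (by omega), labZ_none (by omega)⟩
  by_cases hi2 : i ≤ (N + 1) * (N + 1) + N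
  · exact red i (by omega) hi2 j
  by_cases hL : ∃ (δ : ℤ) (κ : ℕ), -N ≤ δ ∧ δ ≤ N ∧ i + δ = κ * κ
  · obtain ⟨δ, κ, hδ1, hδ2, hκ⟩ := hL
    have hκN : N + 1 ≤ κ := by
      by_contra hcon
      push Not at hcon
      have hk0 : (0 : ℤ) ≤ κ := by positivity
      nlinarith
    have hw1 : (((w.length + 1 : ℕ) : ℤ)) = N + 1 := by push_cast; omega
    refine good_of_couple x (R := fun a b => a = κ ∧ b = w.length + 1) (i2 := (N + 1) * (N + 1) - δ)
      (j2 := j) (hR_single x hx κ (w.length + 1)) (fun d _ _ => ?_) (fun d hd1 hd2 => ?_)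
      (fun e _ _ => Iff.rfl) (red _ (by omega) (by omega) j)
    · constructor <;> intro hh <;> omega
    · by_cases hd : d = δ
      · right
        refine ⟨κ, w.length + 1, (labZ_iff _ _).2 (by rw [hd, hκ]), (labZ_iff _ _).2 ?_, rfl, rfl⟩
        rw [hw1, hd]; ring
      · left
        constructor
        · rw [Option.eq_none_iff_forall_ne_some]
          intro b hb
          rw [labZ_iff] at hb
          have : b = κ := sq_unique hN0 hκN (by omega) (by omega)
          subst this
          apply hd; omega
        · rw [Option.eq_none_iff_forall_ne_some]
          intro b hb
          rw [labZ_iff] at hb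
          have : b = w.length + 1 := sq_unique (N := N) hN0 (by omega)
            (by rw [hw1]; omega) (by rw [hw1]; omega)
          rw [this, hw1] at hb
          apply hd; omega
  · push Not at hL
    refine good_of_couple x (R := fun a b => a = b) (i2 := -N - 1) (j2 := j) (hR_eq x)
      (fun d _ _ => by omega) (fun d hd1 hd2 => ?_) (fun e _ _ => Iff.rfl) (base j)
    left
    refine ⟨?_, labZ_none (by omega)⟩
    rw [Option.eq_none_iff_forall_ne_some]
    intro b hb
    rw [labZ_iff] at hb
    exact hL d b (by omega) (by omega) hb

/-- machine step on natural numbers with offset `S` -/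
def stN (S : ℕ) (l : Fin 3 × Bool) (s : ℕ × ℕ × List (ℕ × Bool)) : ℕ × ℕ × List (ℕ × Bool) :=
  if l.1 = 0 then (if l.2 = true then s.1 + 1 else s.1 - 1, s.2.1, s.2.2)
  else if l.1 = 1 then
    (s.1, if s.1 = S then (if l.2 = true then s.2.1 + 1 else s.2.1 - 1) else s.2.1, s.2.2)
  else (s.1, s.2.1, if S ≤ s.2.1 then (if S ≤ s.1 then (if (Nat.unpair (s.1 - S)).1 = 0 then
      ((Nat.unpair (s.1 - S)).2, l.2) :: s.2.2 else s.2.2) else s.2.2) else s.2.2)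

/-- machine run -/
def simN (S : ℕ) (w : List (Fin 3 × Bool)) (s : ℕ × ℕ × List (ℕ × Bool)) : ℕ × ℕ × List (ℕ × Bool) :=
  w.foldr (stN S) s

theorem simN_run (S : ℕ) (w : List (Fin 3 × Bool)) (P J : ℕ) (hP : w.length ≤ P) (hJ : w.length ≤ J) :
    runZ w ((P : ℤ) - S) ((J : ℤ) - S) = (((simN S w (P, J, [])).1 : ℤ) - S,
      ((simN S w (P, J, [])).2.1 : ℤ) - S, (simN S w (P, J, [])).2.2) ∧
      P ≤ (simN S w (P, J, [])).1 + w.length ∧ J ≤ (simN S w (P, J, [])).2.1 + w.length := by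
  induction w with
  | nil => simp [runZ, simN]
  | cons l w ih =>
    simp only [List.length_cons] at hP hJ
    obtain ⟨h1, h2, h3⟩ := ih (by omega) (by omega)
    have e1 : runZ (l :: w) ((P : ℤ) - S) ((J : ℤ) - S) = stZ l (runZ w ((P : ℤ) - S) ((J : ℤ) - S)) := rfl
    have e2 : simN S (l :: w) (P, J, []) = stN S l (simN S w (P, J, [])) := rfl
    rw [e1, e2, h1]
    generalize simN S w (P, J, []) = s at h1 h2 h3
    obtain ⟨p, q, o⟩ := s
    simp only [List.length_cons] at *
    unfold stZ stN
    by_cases hl0 : l.1 = 0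
    · simp only [hl0, if_true, Prod.mk.injEq, and_true, true_and]
      cases l.2 with
      | true => simp only [sg, if_true]; push_cast; refine ⟨by ring, by omega, by omega⟩
      | false => simp only [sg, Bool.false_eq_true, if_false]; refine ⟨by omega, by omega, by omega⟩
    by_cases hl1 : l.1 = 1
    · by_cases hz : p = S
      · subst hz
        cases l.2 with
        | true => 
          simp only [hl1, sg, if_true, sub_self]
          refine ⟨?_, by simp; omega, by simp; omega⟩
          simp
          ring
        | false => 
          simp only [hl1, sg, sub_self, Bool.false_eq_true, if_false, if_true]
          refine ⟨?_, by simp; omega, ?_⟩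
          · simp
            omega
          · simp; omega
      · have hz2 : ¬ ((p : ℤ) - S = 0) := by omega
        simp only [hl1, hz, hz2, if_false]
        refine ⟨?_, ?_, ?_⟩
        · simp
        · simp; omega
        · simp; omega
    · simp only [hl0, hl1, if_false]
      refine ⟨?_, by omega, by omega⟩
      by_cases hq : S ≤ q
      · have hq2 : (0 : ℤ) ≤ (q : ℤ) - S := by omega
        simp only [hq, hq2, if_true]
        unfold labZ
        by_cases hp : S ≤ p
        · have hp2 : (0 : ℤ) ≤ (p : ℤ) - S := by omega
          have hp3 : ((p : ℤ) - S).toNat = p - S := by omega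
          simp only [hp, hp2, if_true, hp3]
          unfold labN
          by_cases hu : (Nat.unpair (p - S)).1 = 0 <;> simp [hu]
        · have hp2 : ¬ ((0 : ℤ) ≤ (p : ℤ) - S) := by omega
          simp only [hp, hp2, if_false]
          simp
      · have hq2 : ¬ ((0 : ℤ) ≤ (q : ℤ) - S) := by omega
        simp only [hq, hq2, if_false]

/-- single test -/
def chkN1 (dK : List (ℕ × Bool) → Bool) (w : List (Fin 3 × Bool)) (t s : ℕ) : Bool :=
  decide ((simN (2 * w.length + 1) w (w.length + t, w.length + s, [])).1 = w.length + t) &&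
    (decide ((simN (2 * w.length + 1) w (w.length + t, w.length + s, [])).2.1 = w.length + s) &&
      dK (simN (2 * w.length + 1) w (w.length + t, w.length + s, [])).2.2)

theorem chkN1_iff {dK : List (ℕ × Bool) → Bool} (hdK : ∀ o, dK o = true ↔ evalWord x o = 1)
    (w : List (Fin 3 × Bool)) (t s : ℕ) :
    chkN1 dK w t s = true ↔ GoodZ x w ((t : ℤ) - w.length - 1) ((s : ℤ) - w.length - 1) := by
  have h := (simN_run (2 * w.length + 1) w (w.length + t) (w.length + s) (by omega) (by omega)).1
  have e1 : ((w.length + t : ℕ) : ℤ) - (2 * w.length + 1 : ℕ) = (t : ℤ) - w.length - 1 := by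
    push_cast; ring
  have e2 : ((w.length + s : ℕ) : ℤ) - (2 * w.length + 1 : ℕ) = (s : ℤ) - w.length - 1 := by
    push_cast; ring
  rw [e1, e2] at h
  unfold GoodZ chkN1
  rw [h]
  simp only [Bool.and_eq_true, decide_eq_true_eq, hdK]
  refine and_congr ?_ (and_congr ?_ Iff.rfl)
  · constructor <;> intro hh <;> omega
  · constructor <;> intro hh <;> omega

/-- complete test -/
def chkN (dK : List (ℕ × Bool) → Bool) (w : List (Fin 3 × Bool)) : Bool :=
  (List.range ((w.length + 1) * (w.length + 1) + 2 * w.length + 2)).all fun t =>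
    (List.range (2 * w.length + 2)).all fun s => chkN1 dK w t s

theorem chkN_iff (hx : ∀ k (e : ℤ), x k ^ e = 1 → e = 0) {dK : List (ℕ × Bool) → Bool}
    (hdK : ∀ o, dK o = true ↔ evalWord x o = 1)
    (w : List (Fin 3 × Bool)) : chkN dK w = true ↔ rhoL x (FreeGroup.mk w) = 1 := by
  rw [rhoL_one_iff]
  change _ ↔ ∀ i j, GoodZ x w i j
  unfold chkN
  simp only [List.all_eq_true, List.mem_range, chkN1_iff x hdK]
  constructor
  · intro h
    apply good_finite x hx
    intro i j hi1 hi2 hj1 hj2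
    obtain ⟨t, ht⟩ : ∃ t : ℕ, (t : ℤ) = i + w.length + 1 := ⟨(i + w.length + 1).toNat, by omega⟩
    obtain ⟨s, hs⟩ : ∃ s : ℕ, (s : ℤ) = j + w.length + 1 := ⟨(j + w.length + 1).toNat, by omega⟩
    have := h t (by zify; omega) s (by omega)
    rw [ht, hs] at this
    have a1 : i + (w.length : ℤ) + 1 - w.length - 1 = i := by ring
    have a2 : j + (w.length : ℤ) + 1 - w.length - 1 = j := by ring
    rwa [a1, a2] at this
  · intro h t _ s _
    exact h _ _

end LineWP


section LineComp

theorem comp_stN : Computable fun q : (ℕ × (Fin 3 × Bool)) × (ℕ × ℕ × List (ℕ × Bool)) =>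
    stN q.1.1 q.1.2 q.2 := by
  have hS : Primrec fun q : (ℕ × (Fin 3 × Bool)) × (ℕ × ℕ × List (ℕ × Bool)) => q.1.1 :=
    Primrec.fst.comp Primrec.fst
  have hg : Primrec fun q : (ℕ × (Fin 3 × Bool)) × (ℕ × ℕ × List (ℕ × Bool)) => q.1.2.1 :=
    Primrec.fst.comp (Primrec.snd.comp Primrec.fst)
  have hb : Primrec fun q : (ℕ × (Fin 3 × Bool)) × (ℕ × ℕ × List (ℕ × Bool)) => q.1.2.2 :=
    Primrec.snd.comp (Primrec.snd.comp Primrec.fst)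
  have hp : Primrec fun q : (ℕ × (Fin 3 × Bool)) × (ℕ × ℕ × List (ℕ × Bool)) => q.2.1 :=
    Primrec.fst.comp Primrec.snd
  have hj : Primrec fun q : (ℕ × (Fin 3 × Bool)) × (ℕ × ℕ × List (ℕ × Bool)) => q.2.2.1 :=
    Primrec.fst.comp (Primrec.snd.comp Primrec.snd)
  have ho : Primrec fun q : (ℕ × (Fin 3 × Bool)) × (ℕ × ℕ × List (ℕ × Bool)) => q.2.2.2 :=
    Primrec.snd.comp (Primrec.snd.comp Primrec.snd)
  have hu := Primrec.unpair.comp (Primrec.nat_sub.comp hp hS)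
  have mv : ∀ {f : (ℕ × (Fin 3 × Bool)) × (ℕ × ℕ × List (ℕ × Bool)) → ℕ}, Primrec f →
      Primrec fun q => if q.1.2.2 = true then f q + 1 else f q - 1 := fun hf =>
    Primrec.ite (Primrec.eq.comp hb (Primrec.const true)) (Primrec.succ.comp hf) (Primrec.pred.comp hf)
  unfold stN
  apply Primrec.to_comp
  refine Primrec.ite (Primrec.eq.comp hg (Primrec.const 0)) (Primrec.pair (mv hp) (Primrec.pair hj ho)) ?_
  refine Primrec.ite (Primrec.eq.comp hg (Primrec.const 1)) (Primrec.pair hp (Primrec.pair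
    (Primrec.ite (Primrec.eq.comp hp hS) (mv hj) hj) ho)) ?_
  refine Primrec.pair hp (Primrec.pair hj ?_)
  refine Primrec.ite (Primrec.nat_le.comp hS hj) ?_ ho
  refine Primrec.ite (Primrec.nat_le.comp hS hp) ?_ ho
  refine Primrec.ite (Primrec.eq.comp (Primrec.fst.comp hu) (Primrec.const 0)) ?_ ho
  exact Primrec.list_cons.comp (Primrec.pair (Primrec.snd.comp hu) hb) ho

theorem comp_simN {α : Type} [Primcodable α] {S : α → ℕ} {w : α → List (Fin 3 × Bool)}
    {s : α → ℕ × ℕ × List (ℕ × Bool)} (hS : Computable S) (hw : Computable w) (hs : Computable s) :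
    Computable fun a => simN (S a) (w a) (s a) := by
  have h : Computable fun x : α × ((Fin 3 × Bool) × (ℕ × ℕ × List (ℕ × Bool))) =>
      stN (S x.1) x.2.1 x.2.2 :=
    comp_stN.comp (g := fun x : α × ((Fin 3 × Bool) × (ℕ × ℕ × List (ℕ × Bool))) =>
      ((S x.1, x.2.1), x.2.2)) (Computable.pair (Computable.pair (hS.comp Computable.fst)
        (Computable.fst.comp Computable.snd)) (Computable.snd.comp Computable.snd))
  exact comp_foldr (h := fun a q => stN (S a) q.1 q.2) hw hs h

theorem comp_chkN1_aux {dK : List (ℕ × Bool) → Bool} (hdK : Computable dK) {α : Type} [Primcodable α]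
    {r : α → ℕ × ℕ × List (ℕ × Bool)} {P J : α → ℕ} (hr : Computable r) (hP : Computable P)
    (hJ : Computable J) :
    Computable fun a => decide ((r a).1 = P a) && (decide ((r a).2.1 = J a) && dK (r a).2.2) := by
  have h1 : Computable fun a => (r a).1 := Computable.fst.comp hr
  have h2 : Computable fun a => (r a).2.1 := Computable.fst.comp (Computable.snd.comp hr)
  have h3 : Computable fun a => (r a).2.2 := Computable.snd.comp (Computable.snd.comp hr)
  exact comp_and (comp_decEq h1 hP) (comp_and (comp_decEq h2 hJ) (hdK.comp h3))

theorem comp_chkN1 {dK : List (ℕ × Bool) → Bool} (hdK : Computable dK) :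
    Computable fun q : (List (Fin 3 × Bool) × ℕ) × ℕ => chkN1 dK q.1.1 q.1.2 q.2 := by
  have hw : Computable fun q : (List (Fin 3 × Bool) × ℕ) × ℕ => q.1.1 :=
    Computable.fst.comp Computable.fst
  have hl : Computable fun q : (List (Fin 3 × Bool) × ℕ) × ℕ => q.1.1.length :=
    Computable.list_length.comp hw
  have hP : Computable fun q : (List (Fin 3 × Bool) × ℕ) × ℕ => q.1.1.length + q.1.2 :=
    Primrec.nat_add.to_comp.comp hl (Computable.snd.comp Computable.fst)
  have hJ : Computable fun q : (List (Fin 3 × Bool) × ℕ) × ℕ => q.1.1.length + q.2 :=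
    Primrec.nat_add.to_comp.comp hl Computable.snd
  have hS : Computable fun q : (List (Fin 3 × Bool) × ℕ) × ℕ => 2 * q.1.1.length + 1 :=
    (Primrec.succ.comp (Primrec.nat_mul.comp (Primrec.const 2) Primrec.id)).to_comp.comp hl
  have hs : Computable fun q : (List (Fin 3 × Bool) × ℕ) × ℕ =>
      ((q.1.1.length + q.1.2, q.1.1.length + q.2, []) : ℕ × ℕ × List (ℕ × Bool)) :=
    Computable.pair hP (Computable.pair hJ (Computable.const _))
  exact comp_chkN1_aux hdK (comp_simN hS hw hs) hP hJ

theorem comp_chkN {dK : List (ℕ × Bool) → Bool} (hdK : Computable dK) : Computable (chkN dK) := by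
  have hl : Computable fun w : List (Fin 3 × Bool) => w.length := Computable.list_length
  have h1 : Computable fun w : List (Fin 3 × Bool) =>
      List.range ((w.length + 1) * (w.length + 1) + 2 * w.length + 2) := by
    have : Primrec fun n : ℕ => List.range ((n + 1) * (n + 1) + 2 * n + 2) :=
      Primrec.list_range.comp (Primrec.nat_add.comp (Primrec.nat_add.comp
        (Primrec.nat_mul.comp Primrec.succ Primrec.succ)
        (Primrec.nat_mul.comp (Primrec.const 2) Primrec.id)) (Primrec.const 2))
    exact this.to_comp.comp hl
  have h2 : Computable fun w : List (Fin 3 × Bool) × ℕ => List.range (2 * w.1.length + 2) := by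
    have : Primrec fun n : ℕ => List.range (2 * n + 2) :=
      Primrec.list_range.comp (Primrec.nat_add.comp
        (Primrec.nat_mul.comp (Primrec.const 2) Primrec.id) (Primrec.const 2))
    exact this.to_comp.comp (hl.comp Computable.fst)
  have h3 := comp_all (p := fun (q : List (Fin 3 × Bool) × ℕ) (s : ℕ) => chkN1 dK q.1 q.2 s) h2
    (comp_chkN1 hdK)
  exact comp_all (p := fun (w : List (Fin 3 × Bool)) (t : ℕ) =>
    (List.range (2 * w.length + 2)).all fun s => chkN1 dK w t s) h1 h3

theorem rhoL_decidable {K : Type} [Group K] (x : ℕ → K) (hx : ∀ k (e : ℤ), x k ^ e = 1 → e = 0)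
    (hd : ComputablePred fun o : List (ℕ × Bool) => evalWord x o = 1) :
    DecidableWordProblemVia (rhoL x) := by
  obtain ⟨dK, hc, hdK⟩ := pred_to_bool hd
  exact computable_of_pred (chkN dK) (comp_chkN hc) (chkN_iff x hx hdK)

end LineComp

section Family

variable (n : ℕ → ℕ) (G : ℕ → Type) [∀ i, Group (G i)] (π : ∀ i, FreeGroup (Fin (n i)) →* G i)

/-- the ambient group of the family -/
abbrev KK := (∀ i, G i) × Multiplicative ℤ

/-- component value of a generator -/
noncomputable def gv (i j : ℕ) : G i := if h : j < n i then π i (FreeGroup.of ⟨j, h⟩) else 1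

/-- the generating sequence -/
noncomputable def xx (k : ℕ) : KK G :=
  (Pi.mulSingle (Nat.unpair k).1 (gv n G π (Nat.unpair k).1 (Nat.unpair k).2), Multiplicative.ofAdd 1)

theorem xx_inf (k : ℕ) (e : ℤ) (h : xx n G π k ^ e = 1) : e = 0 := by
  have h1 := congrArg Prod.snd h
  have h2 : (Multiplicative.ofAdd (1 : ℤ)) ^ e = 1 := h1
  rw [← ofAdd_zsmul] at h2
  simpa using h2

theorem single_mem (hπ : ∀ i, Function.Surjective (π i)) (i : ℕ) (g : G i) :
    ((Pi.mulSingle i g, 1) : KK G) ∈ Subgroup.closure (Set.range (xx n G π)) := by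
  have hx : ∀ k, xx n G π k ∈ Subgroup.closure (Set.range (xx n G π)) :=
    fun k => Subgroup.subset_closure ⟨k, rfl⟩
  have ht : ((1, Multiplicative.ofAdd 1) : KK G) ∈ Subgroup.closure (Set.range (xx n G π)) := by
    have := hx (Nat.pair 0 (n 0))
    simpa [xx, gv] using this
  have hgen : ∀ j : Fin (n i), ((Pi.mulSingle i (π i (FreeGroup.of j)), 1) : KK G) ∈
      Subgroup.closure (Set.range (xx n G π)) := by
    intro j
    have := mul_mem (hx (Nat.pair i j)) (inv_mem ht)
    have e : xx n G π (Nat.pair i j) * ((1, Multiplicative.ofAdd 1) : KK G)⁻¹ =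
        (Pi.mulSingle i (π i (FreeGroup.of j)), 1) := by
      have h1 : gv n G π i j = π i (FreeGroup.of j) := by simp [gv]
      unfold xx
      rw [Nat.unpair_pair]
      simp [h1]
    rwa [e] at this
  obtain ⟨f, rfl⟩ := hπ i g
  have : (⊤ : Subgroup (FreeGroup (Fin (n i)))) ≤ (Subgroup.closure (Set.range (xx n G π))).comap
      (((MonoidHom.inl (∀ i, G i) (Multiplicative ℤ)).comp (MonoidHom.mulSingle G i)).comp (π i)) := by
    rw [← FreeGroup.closure_range_of, Subgroup.closure_le]
    rintro _ ⟨j, rfl⟩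
    exact hgen j
  exact this (Subgroup.mem_top f)

/-- relevant part of a word for one component -/
def filt (n : ℕ → ℕ) (o : List (ℕ × Bool)) (i : ℕ) : List (ℕ × Bool) :=
  (o.filter fun p => decide ((Nat.unpair p.1).1 = i) && decide ((Nat.unpair p.1).2 < n i)).map
    fun p => ((Nat.unpair p.1).2, p.2)

theorem evalWord_snd (o : List (ℕ × Bool)) :
    (evalWord (xx n G π) o).2 = Multiplicative.ofAdd
      (((o.filter fun p => p.2).length : ℤ) - (o.filter fun p => !p.2).length) := by
  induction o with
  | nil => simp [evalWord]
  | cons p o ih =>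
    obtain ⟨k, b⟩ := p
    rw [evalWord_cons, Prod.snd_mul, ih]
    cases b
    · simp only [xb, xx, Bool.false_eq_true, if_false, Prod.snd_inv]
      rw [← ofAdd_neg, ← ofAdd_add]
      congr 1
      simp
      ring
    · simp only [xb, xx, if_true]
      rw [← ofAdd_add]
      congr 1
      simp
      ring

theorem evalWord_fst (i : ℕ) (o : List (ℕ × Bool)) :
    ∃ w : List (Fin (n i) × Bool), w.map (fun p => ((p.1 : ℕ), p.2)) = filt n o i ∧
      (evalWord (xx n G π) o).1 i = π i (FreeGroup.mk w) := by
  induction o with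
  | nil => exact ⟨[], by simp [filt], by simp [evalWord, ← FreeGroup.one_eq_mk]⟩
  | cons p o ih =>
    obtain ⟨w, h1, h2⟩ := ih
    obtain ⟨k, b⟩ := p
    rw [evalWord_cons, Prod.fst_mul, Pi.mul_apply, h2]
    by_cases hk : (Nat.unpair k).1 = i ∧ (Nat.unpair k).2 < n i
    · obtain ⟨hk1, hk2⟩ := hk
      refine ⟨(⟨(Nat.unpair k).2, hk2⟩, b) :: w, ?_, ?_⟩
      · rw [List.map_cons, h1]
        simp [filt, hk1, hk2]
      · have e1 : FreeGroup.mk ((⟨(Nat.unpair k).2, hk2⟩, b) :: w) =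
            FreeGroup.mk [((⟨(Nat.unpair k).2, hk2⟩ : Fin (n i)), b)] * FreeGroup.mk w := by
          rw [FreeGroup.mul_mk]; rfl
        rw [e1, map_mul]
        congr 1
        subst hk1
        cases b
        · have e2 : FreeGroup.mk [((⟨(Nat.unpair k).2, hk2⟩ : Fin (n (Nat.unpair k).1)), false)] =
            (FreeGroup.of ⟨(Nat.unpair k).2, hk2⟩)⁻¹ := rfl
          rw [e2]
          simp [xb, xx, gv, hk2]
        · have e2 : FreeGroup.mk [((⟨(Nat.unpair k).2, hk2⟩ : Fin (n (Nat.unpair k).1)), true)] =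
            (FreeGroup.of ⟨(Nat.unpair k).2, hk2⟩) := rfl
          rw [e2]
          simp [xb, xx, gv, hk2]
    · refine ⟨w, ?_, ?_⟩
      · rw [h1]
        have : (decide ((Nat.unpair k).1 = i) && decide ((Nat.unpair k).2 < n i)) = false := by
          simpa using hk
        simp only [filt, List.filter_cons, this]
        simp
      · have e : (xx n G π k).1 i = 1 := by
          simp only [xx]
          by_cases h1 : (Nat.unpair k).1 = i
          · subst h1
            have h2 : ¬ ((Nat.unpair k).2 < n (Nat.unpair k).1) := fun h => hk ⟨rfl, h⟩
            simp [gv, h2]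
          · exact Pi.mulSingle_eq_of_ne (Ne.symm h1) _
        have e2 : (xb (xx n G π) k b).1 i = 1 := by
          cases b
          · simp [xb, e]
          · simp [xb, e]
        rw [e2, one_mul]

theorem filt_nil (o : List (ℕ × Bool)) (i : ℕ) (h : ∀ p ∈ o, (Nat.unpair p.1).1 ≠ i) :
    filt n o i = [] := by
  unfold filt
  rw [List.map_eq_nil_iff, List.filter_eq_nil_iff]
  intro p hp
  simp [h p hp]

theorem KK_decidable (hn : Computable n) (P : ℕ × List (ℕ × Bool) → Prop) (hP : ComputablePred P)
    (hPc : ∀ i (w : List (Fin (n i) × Bool)),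
      P (i, w.map (fun p => ((p.1 : ℕ), p.2))) ↔ π i (FreeGroup.mk w) = 1) :
    ComputablePred fun o : List (ℕ × Bool) => evalWord (xx n G π) o = 1 := by
  obtain ⟨f, hf, hfP⟩ := pred_to_bool hP
  have hcomp : ∀ i o, f (i, filt n o i) = true ↔ (evalWord (xx n G π) o).1 i = 1 := by
    intro i o
    obtain ⟨w, h1, h2⟩ := evalWord_fst n G π i o
    rw [hfP, ← h1, hPc, h2]
  refine computable_of_pred (fun o : List (ℕ × Bool) =>
    decide ((o.filter fun p => p.2).length = (o.filter fun p => !p.2).length) &&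
      o.all fun p => f ((Nat.unpair p.1).1, filt n o (Nat.unpair p.1).1)) ?_ ?_
  · have h1 : Computable fun o : List (ℕ × Bool) => (o.filter fun p => p.2).length :=
      Computable.list_length.comp (comp_filter
        (p := fun (_ : List (ℕ × Bool)) (p : ℕ × Bool) => p.2) Computable.id
        (Computable.snd.comp Computable.snd))
    have h2 : Computable fun o : List (ℕ × Bool) => (o.filter fun p => !p.2).length :=
      Computable.list_length.comp (comp_filter
        (p := fun (_ : List (ℕ × Bool)) (p : ℕ × Bool) => !p.2) Computable.id
        ((Primrec.not.to_comp.comp Computable.snd).comp Computable.snd))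
    have hu : Computable fun q : ℕ × Bool => Nat.unpair q.1 := Computable.unpair.comp Computable.fst
    have h3 : Computable fun q : List (ℕ × Bool) × ℕ => filt n q.1 q.2 := by
      have a1 : Computable fun r : (List (ℕ × Bool) × ℕ) × (ℕ × Bool) => Nat.unpair r.2.1 :=
        hu.comp Computable.snd
      have a2 : Computable fun r : (List (ℕ × Bool) × ℕ) × (ℕ × Bool) =>
          decide ((Nat.unpair r.2.1).1 = r.1.2) :=
        comp_decEq (Computable.fst.comp a1) (Computable.snd.comp Computable.fst)
      have a3 : Computable fun r : (List (ℕ × Bool) × ℕ) × (ℕ × Bool) =>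
          decide ((Nat.unpair r.2.1).2 < n r.1.2) :=
        (PrimrecRel.decide Primrec.nat_lt).to_comp.comp (Computable.snd.comp a1)
          (hn.comp (Computable.snd.comp Computable.fst))
      have a4 := comp_and a2 a3
      have a5 : Computable fun q : List (ℕ × Bool) × ℕ =>
        q.1.filter fun p => decide ((Nat.unpair p.1).1 = q.2) && decide ((Nat.unpair p.1).2 < n q.2) :=
        comp_filter (p := fun (q : List (ℕ × Bool) × ℕ) (p : ℕ × Bool) =>
          decide ((Nat.unpair p.1).1 = q.2) && decide ((Nat.unpair p.1).2 < n q.2)) Computable.fst a4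
      have a6 : Computable fun r : (List (ℕ × Bool) × ℕ) × (ℕ × Bool) =>
          ((Nat.unpair r.2.1).2, r.2.2) :=
        Computable.pair (Computable.snd.comp a1) (Computable.snd.comp Computable.snd)
      have a7 : Computable₂ fun (_ : List (ℕ × Bool) × ℕ) (p : ℕ × Bool) =>
          ((Nat.unpair p.1).2, p.2) := a6
      have a8 := comp_map a5 a7
      unfold filt
      exact a8
    have h4 : Computable fun q : List (ℕ × Bool) × (ℕ × Bool) => (Nat.unpair q.2.1).1 :=
      Computable.fst.comp (hu.comp Computable.snd)
    have h6 : Computable fun q : List (ℕ × Bool) × (ℕ × Bool) =>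
        filt n q.1 (Nat.unpair q.2.1).1 := by
      have h7 : Computable fun q : List (ℕ × Bool) × (ℕ × Bool) =>
          (q.1, (Nat.unpair q.2.1).1) := Computable.pair Computable.fst h4
      have h8 := Computable.comp h3 h7
      exact h8
    have h5 : Computable fun q : List (ℕ × Bool) × (ℕ × Bool) =>
        f ((Nat.unpair q.2.1).1, filt n q.1 (Nat.unpair q.2.1).1) :=
      hf.comp (Computable.pair h4 h6)
    have h9 : Computable₂ fun (o : List (ℕ × Bool)) (p : ℕ × Bool) =>
      f ((Nat.unpair p.1).1, filt n o (Nat.unpair p.1).1) := h5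
    have h10 := comp_all Computable.id h9
    have h11 := comp_decEq h1 h2
    have h12 := comp_and h11 h10
    exact h12
  · intro o
    rw [Bool.and_eq_true, decide_eq_true_eq, List.all_eq_true]
    simp only [hcomp]
    constructor
    · rintro ⟨h1, h2⟩
      refine Prod.ext ?_ ?_
      · funext i
        by_cases hi : ∃ p ∈ o, (Nat.unpair p.1).1 = i
        · obtain ⟨p, hp, rfl⟩ := hi
          exact h2 p hp
        · push Not at hi
          obtain ⟨w, h3, h4⟩ := evalWord_fst n G π i o
          rw [filt_nil n o i hi, List.map_eq_nil_iff] at h3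
          rw [h4, h3, ← FreeGroup.one_eq_mk, map_one]; rfl
      · rw [evalWord_snd, h1]; simp
    · intro h
      refine ⟨?_, fun p _ => by rw [h]; rfl⟩
      have h1 := congrArg Prod.snd h
      rw [evalWord_snd] at h1
      have h2 : (((o.filter fun p => p.2).length : ℤ) - (o.filter fun p => !p.2).length) = 0 :=
        congrArg Multiplicative.toAdd h1
      omega

theorem xx_fin (i : ℕ) :
    (Set.range fun k => (Pi.evalMonoidHom G i).comp (MonoidHom.fst _ (Multiplicative ℤ)) (xx n G π k)).Finite := by
  refine ((Set.finite_range fun j : Fin (n i) => π i (FreeGroup.of j)).insert 1).subset ?_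
  rintro _ ⟨k, rfl⟩
  simp only [MonoidHom.comp_apply, MonoidHom.coe_fst, Pi.evalMonoidHom_apply, xx]
  by_cases h1 : (Nat.unpair k).1 = i
  · subst h1
    rw [Pi.mulSingle_eq_same]
    unfold gv
    split_ifs with h
    · right; exact ⟨_, rfl⟩
    · left; rfl
  · left
    exact Pi.mulSingle_eq_of_ne (Ne.symm h1) _

end Family

theorem family_decidable_word_problem_embedding_into_fg_simple
    (n : ℕ → ℕ) (hn : Computable n)
    (G : ℕ → Type) [∀ i, Group (G i)]
    (π : ∀ i, FreeGroup (Fin (n i)) →* G i) (hπ : ∀ i, Function.Surjective (π i))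
    (P : ℕ × List (ℕ × Bool) → Prop) (hP : ComputablePred P)
    (hPc : ∀ i (w : List (Fin (n i) × Bool)),
      P (i, w.map (fun p => ((p.1 : ℕ), p.2))) ↔ π i (FreeGroup.mk w) = 1) :
    ∃ (H : Type) (_ : Group H), Group.FG H ∧ IsSimpleGroup H ∧
      (∃ (m : ℕ) (ρ : FreeGroup (Fin m) →* H),
        Function.Surjective ρ ∧ DecidableWordProblemVia ρ) ∧
      ∀ i, ∃ (X : Finset (G i)) (Y : Finset H) (φ : G i →* H),
        Generates X ∧ Generates Y ∧ IsQIEmbedding X Y φ ∧ IsFrattini φ := by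
  classical
  have := LL_infinite (xx n G π)
  obtain ⟨H, hH, hFG, hS, hWP, ψ, hψF, hψQ⟩ := stepB (rhoL (xx n G π)) (rhoL_surj (xx n G π))
    (rhoL_decidable (xx n G π) (xx_inf n G π) (KK_decidable n G π hn P hP hPc))
  refine ⟨H, hH, hFG, hS, hWP, fun i => ?_⟩
  have hZ : Generates (Finset.univ.image (genL (xx n G π))) := by
    unfold Generates
    rw [Finset.coe_image, Finset.coe_univ, Set.image_univ, genL_closure]
  have hX : Generates (Finset.univ.image (fun j => π i (FreeGroup.of j))) := by
    unfold Generates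
    rw [Finset.coe_image, Finset.coe_univ, Set.image_univ]
    have h1 := MonoidHom.map_closure (π i) (Set.range FreeGroup.of)
    rw [FreeGroup.closure_range_of, Subgroup.map_top_of_surjective _ (hπ i),
      ← Set.range_comp] at h1
    exact h1.symm
  obtain ⟨φ, h1, h2⟩ := LL_embed (xx n G π)
    ((MonoidHom.inl _ (Multiplicative ℤ)).comp (MonoidHom.mulSingle G i))
    ((Pi.evalMonoidHom G i).comp (MonoidHom.fst _ (Multiplicative ℤ)))
    (fun g => by simp) (fun g => single_mem n G π hπ i g) (xx_fin n G π i) hX hZ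
    (fun y hy => by
      obtain ⟨g, _, hg⟩ := Finset.mem_image.1 hy
      exact ⟨g, hg.symm⟩)
  obtain ⟨Y, hY, hQ⟩ := hψQ _ hZ
  exact ⟨_, Y, ψ.comp φ, hX, hY, qi_comp h1 hQ, frattini_comp h2 hψF⟩
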